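/- arXiv:2210.16832 — 2 statements merged into one kernel-verified Lean document; each statement's English description precedes it below -/
import Mathlib

section
/- Let f ∈ H be an element of the Connes–Kreimer Hopf algebra of rooted trees with coproduct Δ(f) = Σ f' ⊗ f''. Then for all s, s' ∈ μ_r and all v, w ∈ A_r: F_f ⋄_s (v z_{s'}^δ w) = Σ (F_{f'} ⋄_s v) z_{s'}^δ (F_{f''} ⋄_{s'} w). -/
open FreeAlgebra

/-- Alphabet of `A_1 = ℚ⟨x,y⟩`. -/
inductive LetA : Type | x : LetA | y : LetA

/-- Alphabet of `A_r = ℚ⟨x, y_s : s ∈ μ_r⟩`; the group `G` plays the role of `μ_r`. -/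
inductive LetR (G : Type) : Type | x : LetR G | y : G → LetR G

/-- `A_1 = ℚ⟨x, y⟩`. -/
abbrev A1 : Type := FreeAlgebra ℚ LetA

/-- `A_r = ℚ⟨x, y_s : s ∈ μ_r⟩`. -/
abbrev Ar (G : Type) : Type := FreeAlgebra ℚ (LetR G)

noncomputable def X1 : A1 := ι ℚ LetA.x
noncomputable def Y1 : A1 := ι ℚ LetA.y

variable {G : Type} [CommGroup G]

noncomputable def Xr : Ar G := ι ℚ LetR.x
noncomputable def Yr (s : G) : Ar G := ι ℚ (LetR.y s)

/-- `z = x + y_1`. -/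
noncomputable def zet : Ar G := Xr + Yr 1

open scoped Classical in
/-- `z_s^δ = x + δ(s) y_s` with `δ(1) = 0`, `δ(s) = 1` otherwise. -/
noncomputable def zdel (s : G) : Ar G := if s = 1 then Xr else Xr + Yr s

/-- The involutive automorphism `φ` of `A_r`: `φ(x) = z`, `φ(y_s) = z_s^δ - z`. -/
noncomputable def phi : Ar G →ₐ[ℚ] Ar G :=
  lift ℚ (fun l => match l with
    | LetR.x => zet
    | LetR.y s => zdel s - zet)

/-- The natural embedding `A_1 → A_r`, `x ↦ x`, `y ↦ y_1`. -/
noncomputable def jm : A1 →ₐ[ℚ] Ar G :=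
  lift ℚ (fun l => match l with
    | LetA.x => Xr
    | LetA.y => Yr 1)

open scoped Classical in
/-- The anti-automorphism `τ` of `A_r`: `τ(x) = y_1`, `τ(y_1) = x`, `τ(y_s) = -y_s` (`s ≠ 1`). -/
noncomputable def tauR : Ar G →ₗ[ℚ] Ar G :=
  (MulOpposite.opLinearEquiv ℚ).symm.toLinearMap ∘ₗ
    (lift ℚ (fun l => match l with
      | LetR.x => MulOpposite.op (Yr 1)
      | LetR.y s => MulOpposite.op (if s = 1 then Xr else -(Yr s)) ) :
        Ar G →ₐ[ℚ] (Ar G)ᵐᵒᵖ).toLinearMap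

/-- The anti-automorphism `τ` of `A_1`: `τ(x) = y`, `τ(y) = x`. -/
noncomputable def tau1 : A1 →ₗ[ℚ] A1 :=
  (MulOpposite.opLinearEquiv ℚ).symm.toLinearMap ∘ₗ
    (lift ℚ (fun l => match l with
      | LetA.x => MulOpposite.op Y1
      | LetA.y => MulOpposite.op X1) : A1 →ₐ[ℚ] A1ᵐᵒᵖ).toLinearMap

/-- `wordP [(a₁,s₁),...,(a_l,s_l)] = x^{a₁} y_{s₁} ⋯ x^{a_l} y_{s_l}`,
i.e. the word `z_{a₁+1, s₁} ⋯ z_{a_l+1, s_l}`. -/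
noncomputable def wordP (L : List (ℕ × G)) : Ar G :=
  (L.map (fun p => Xr ^ p.1 * Yr p.2)).prod

/-- Cumulative-product reindexing of subscripts: this realizes the composition `I ∘ M_s`
on subscript lists, sending `(s₁, s₂, …, s_l)` to `(s s₁, s s₁ s₂, …, s s₁ ⋯ s_l)`. -/
def cumul : G → List (ℕ × G) → List (ℕ × G)
  | _, [] => []
  | g, p :: L => (p.1, g * p.2) :: cumul (g * p.2) L

/-- All the data entering the definition of the diamond products `⋄_s`:
the harmonic product `*`, the maps `ψ_s = φ ∘ I ∘ M_s`, and the family of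
`ℚ`-bilinear diamond products `D s : A_1 × A_r → A_r` (together with the
corestriction `D1` of `⋄_1` to `A_1 × A_1 → A_1`), each characterized by its
defining recursive rules. -/
structure DiamondSetup (G : Type) [CommGroup G] where
  /-- the harmonic product -/
  hst : Ar G →ₗ[ℚ] Ar G →ₗ[ℚ] Ar G
  one_hst : ∀ w, hst 1 w = w
  hst_one : ∀ v, hst v 1 = v
  hst_xr : ∀ v w, hst (v * Xr) w = hst v w * Xr
  hst_xl : ∀ v w, hst v (w * Xr) = hst v w * Xr
  hst_yy : ∀ (v w : Ar G) (s t : G), hst (v * Yr s) (w * Yr t) =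
      hst v (w * Yr t) * Yr s + hst (v * Yr s) w * Yr t + hst v w * (Xr * Yr (s * t))
  /-- the linear automorphisms `ψ_s = φ ∘ I ∘ M_s` -/
  psi : G → (Ar G ≃ₗ[ℚ] Ar G)
  psi_spec : ∀ (s : G) (L : List (ℕ × G)) (a : ℕ),
      psi s (wordP L * Xr ^ a) = phi (wordP (cumul s L) * Xr ^ a)
  /-- the diamond products `⋄_s : A_1 × A_r → A_r` -/
  D : G → A1 →ₗ[ℚ] Ar G →ₗ[ℚ] Ar G
  one_D : ∀ (s : G) (w : Ar G), D s 1 w = w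
  D_one : ∀ (s : G) (v : A1), D s v 1 = psi s (phi (jm v))
  Dxx : ∀ (s : G) (v : A1) (w : Ar G), D s (v * X1) (w * Xr) =
      D s v (w * Xr) * Xr - D s (v * Y1) w * Xr
  Dyx : ∀ (s : G) (v : A1) (w : Ar G), D s (v * Y1) (w * Xr) =
      D s v (w * Xr) * Yr 1 + D s (v * Y1) w * Xr
  Dxy : ∀ (s : G) (v : A1) (w : Ar G), D s (v * X1) (w * Yr 1) =
      D s v (w * Yr 1) * Xr + D s (v * X1) w * Yr 1
  Dyy : ∀ (s : G) (v : A1) (w : Ar G), D s (v * Y1) (w * Yr 1) =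
      D s v (w * Yr 1) * Yr 1 - D s (v * X1) w * Yr 1
  Dxyt : ∀ (s t : G), t ≠ 1 → ∀ (v : A1) (w : Ar G), D s (v * X1) (w * Yr t) =
      D s v (w * Yr t) * Xr + D s v (w * (Xr + Yr t)) * Yr t - D s (v * Y1) w * Yr t
  Dyyt : ∀ (s t : G), t ≠ 1 → ∀ (v : A1) (w : Ar G), D s (v * Y1) (w * Yr t) =
      D s v (w * Yr t) * Yr 1 - D s v (w * (Xr + Yr t)) * Yr t + D s (v * Y1) w * Yr t
  /-- `⋄_1` as a product `A_1 × A_1 → A_1` -/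
  D1 : A1 →ₗ[ℚ] A1 →ₗ[ℚ] A1
  D1_spec : ∀ u v : A1, jm (D1 u v) = D 1 u (jm v)

open TensorProduct in
/-- Evaluation of a family of endomorphisms at a fixed element, as a linear map. -/
noncomputable def evalT {G : Type} [CommGroup G] {H : Type} [CommRing H] [HopfAlgebra ℚ H]
    (T : H →ₐ[ℚ] Module.End ℚ (Ar G)) (w : Ar G) : H →ₗ[ℚ] Ar G :=
  (LinearMap.applyₗ w).comp T.toLinearMap

open TensorProduct in
/-- The linear map `H ⊗ H → A_r` induced by the bilinear map `(a, b) ↦ (T a)(w) ⋅ (T b)(v)`. -/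
noncomputable def Tpair {G : Type} [CommGroup G] {H : Type} [CommRing H] [HopfAlgebra ℚ H]
    (T : H →ₐ[ℚ] Module.End ℚ (Ar G)) (w v : Ar G) : H ⊗[ℚ] H →ₗ[ℚ] Ar G :=
  TensorProduct.lift (((LinearMap.mul ℚ (Ar G)).compl₂ (evalT T v)).comp (evalT T w))

open TensorProduct in
/-- The Connes–Kreimer Hopf algebra of rooted forests `H` together with the grafting
operator `B_+`, the rooted tree maps `f ↦ f̃`, and the polynomials `F_f`, `G_f ∈ A_1`,
each characterized by its defining properties. -/
structure CKSetup (G : Type) [CommGroup G] (H : Type) [CommRing H] [HopfAlgebra ℚ H] where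
  /-- the diamond/harmonic data on `A_1`, `A_r` -/
  ds : DiamondSetup G
  /-- the grafting operator `B_+` -/
  Bp : H →ₗ[ℚ] H
  /-- the Hochschild 1-cocycle property `Δ(B_+(f)) = B_+(f) ⊗ 𝟙 + (id ⊗ B_+)(Δ f)` -/
  Bp_cocycle : ∀ f : H, Coalgebra.comul (R := ℚ) (Bp f) =
      (Bp f) ⊗ₜ[ℚ] (1 : H) + (TensorProduct.map LinearMap.id Bp) (Coalgebra.comul (R := ℚ) f)
  /-- `H` is generated by rooted forests: it is the smallest subspace containing `1` and
  closed under multiplication and `B_+`. -/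
  hgen : ∀ P : Submodule ℚ H, (1 : H) ∈ P → (∀ a b : H, a ∈ P → b ∈ P → a * b ∈ P) →
      (∀ a ∈ P, Bp a ∈ P) → ∀ h : H, h ∈ P
  /-- the rooted tree maps `f ↦ f̃`, an algebra homomorphism `H → End(A_r)` -/
  T : H →ₐ[ℚ] Module.End ℚ (Ar G)
  /-- rule (I): `•̃(z_s^δ) = z_s^δ (z - z_s^δ)` -/
  T_dot_zdel : ∀ s : G, T (Bp 1) (zdel s) = zdel s * (zet - zdel s)
  /-- rule (I): `•̃(z) = 0` -/
  T_dot_z : T (Bp 1) (zet : Ar G) = 0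
  /-- rule (II): `B_+(f)~(z_s^δ) = R_{z-z_s^δ} R_{2z-z_s^δ} R_{z-z_s^δ}^{-1} f̃(z_s^δ)` -/
  T_graft : ∀ f : H, Coalgebra.counit (R := ℚ) f = 0 → ∀ (s : G) (u : Ar G),
      T f (zdel s) = u * (zet - zdel s) →
      T (Bp f) (zdel s) = u * ((2 : ℚ) • zet - zdel s) * (zet - zdel s)
  /-- `f̃(z_s^δ)` always ends with `z - z_s^δ` (so that rule (II) makes sense) -/
  T_ends : ∀ f : H, Coalgebra.counit (R := ℚ) f = 0 → ∀ s : G, ∃ u : Ar G,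
      T f (zdel s) = u * (zet - zdel s)
  /-- rule (II): `B_+(f)~(z) = 0` -/
  T_graft_z : ∀ f : H, T (Bp f) (zet : Ar G) = 0
  /-- rule (IV): `f̃(wv) = M(Δ(f)~(w ⊗ v))` for `v ∈ {z, z_s^δ}` -/
  T_coprod : ∀ (f : H) (w v : Ar G), (v = zet ∨ ∃ s : G, v = zdel s) →
      T f (w * v) = Tpair T w v (Coalgebra.comul (R := ℚ) f)
  /-- the polynomials `F_f ∈ A_1` -/
  F : H →ₗ[ℚ] A1
  F_one : F 1 = 1
  F_dot : F (Bp 1) = Y1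
  F_ends : ∀ f : H, Coalgebra.counit (R := ℚ) f = 0 → ∃ u : A1, F f = u * Y1
  /-- `F_{B_+(f)} = R_y R_{x+2y} R_y^{-1}(F_f)` for `f ≠ 𝟙` -/
  F_graft : ∀ f : H, Coalgebra.counit (R := ℚ) f = 0 → ∀ u : A1, F f = u * Y1 →
      F (Bp f) = u * (X1 + (2 : ℚ) • Y1) * Y1
  /-- `F_{gh} = F_g ⋄_1 F_h` -/
  F_mul : ∀ g h : H, F (g * h) = ds.D1 (F g) (F h)
  /-- the polynomials `G_f ∈ A_1` -/
  Gm : H →ₗ[ℚ] A1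
  Gm_one : Gm 1 = 1
  Gm_dot : Gm (Bp 1) = -Y1
  /-- `G_{B_+(f)} = L_{2x+y}(G_f)` for `f ≠ 𝟙` -/
  Gm_graft : ∀ f : H, Coalgebra.counit (R := ℚ) f = 0 →
      Gm (Bp f) = ((2 : ℚ) • X1 + Y1) * Gm f
  /-- `G_{gh} = G_g ⋄_1 G_h` -/
  Gm_mul : ∀ g h : H, Gm (g * h) = ds.D1 (Gm g) (Gm h)

section Helpers

set_option linter.unusedSectionVars false

theorem peelR {X : Type} (p : FreeAlgebra ℚ X → Prop) (h1 : p 1)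
    (hadd : ∀ a b, p a → p b → p (a + b)) (hsmul : ∀ (c : ℚ) a, p a → p (c • a))
    (hmul : ∀ a l, p a → p (a * ι ℚ l)) (a : FreeAlgebra ℚ X) : p a := by
  have key : ∀ b : FreeAlgebra ℚ X, ∀ a, p a → p (a * b) := by
    intro b
    induction b using FreeAlgebra.induction with
    | grade0 r =>
      intro a ha
      rw [← Algebra.commutes, ← Algebra.smul_def]
      exact hsmul _ _ ha
    | grade1 x => intro a ha; exact hmul _ _ ha
    | mul b c hb hc => intro a ha; rw [← mul_assoc]; exact hc _ (hb _ ha)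
    | add b c hb hc => intro a ha; rw [mul_add]; exact hadd _ _ (hb _ ha) (hc _ ha)
  simpa using key a 1 h1

theorem peelA (p : A1 → Prop) (h1 : p 1)
    (hadd : ∀ a b, p a → p b → p (a + b)) (hsmul : ∀ (c : ℚ) a, p a → p (c • a))
    (hz : ∀ a, p a → p (a * (X1 + Y1))) (hy : ∀ a, p a → p (a * Y1)) (a : A1) : p a := by
  refine peelR p h1 hadd hsmul ?_ a
  intro a l ha
  cases l with
  | y => exact hy a ha
  | x =>
    have h := hadd _ _ (hz a ha) (hsmul (-1) _ (hy a ha))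
    have e : a * (X1 + Y1) + (-1 : ℚ) • (a * Y1) = a * ι ℚ LetA.x := by
      rw [mul_add, neg_one_smul]; simp [X1]
    rwa [e] at h

theorem zdel_one : (zdel 1 : Ar G) = Xr := by simp [zdel]

theorem zdel_ne {t : G} (ht : t ≠ 1) : (zdel t : Ar G) = Xr + Yr t := by simp [zdel, ht]

theorem peelG (p : Ar G → Prop) (h1 : p 1)
    (hadd : ∀ a b, p a → p b → p (a + b)) (hsmul : ∀ (c : ℚ) a, p a → p (c • a))
    (hz : ∀ a, p a → p (a * zet)) (hd : ∀ a t, p a → p (a * zdel t)) (a : Ar G) : p a := by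
  refine peelR p h1 hadd hsmul ?_ a
  intro a l ha
  have hx : p (a * Xr) := by rw [← zdel_one]; exact hd a 1 ha
  cases l with
  | x => exact hx
  | y t =>
    by_cases ht : t = 1
    · subst ht
      have h := hadd _ _ (hz a ha) (hsmul (-1) _ hx)
      have e : a * zet + (-1 : ℚ) • (a * Xr) = a * ι ℚ (LetR.y 1) := by
        rw [zet, mul_add, neg_one_smul]; simp [Yr]
      rwa [e] at h
    · have h := hadd _ _ (hd a t ha) (hsmul (-1) _ hx)
      have e : a * zdel t + (-1 : ℚ) • (a * Xr) = a * ι ℚ (LetR.y t) := by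
        rw [zdel_ne ht, mul_add, neg_one_smul]; simp [Yr]
      rwa [e] at h

theorem zet_sub_zdel_ne (t : G) : (zet - zdel t : Ar G) ≠ 0 := by
  classical
  intro h
  have h2 := congrArg (lift ℚ (fun l => match l with
    | LetR.x => (0 : ℚ)
    | LetR.y s => if s = 1 then 1 else 0)) h
  by_cases ht : t = 1
  · subst ht
    simp [zdel_one, zet, Xr, Yr] at h2
  · simp [zdel_ne ht, zet, Xr, Yr, ht] at h2

/-- `x ↦ x`, `y ↦ y_s`. -/
noncomputable def kap (s : G) : A1 →ₐ[ℚ] Ar G :=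
  lift ℚ (fun l => match l with
    | LetA.x => Xr
    | LetA.y => Yr s)

/-- `x ↦ z_s^δ`, `y ↦ z - z_s^δ`. -/
noncomputable def alp (s : G) : A1 →ₐ[ℚ] Ar G :=
  lift ℚ (fun l => match l with
    | LetA.x => zdel s
    | LetA.y => zet - zdel s)

/-- the involution of `A_1`. -/
noncomputable def phi1 : A1 →ₐ[ℚ] A1 :=
  lift ℚ (fun l => match l with
    | LetA.x => X1 + Y1
    | LetA.y => - Y1)

theorem phi_X : phi (Xr : Ar G) = zet := by simp [phi, Xr]
theorem phi_Y (s : G) : phi (Yr s : Ar G) = zdel s - zet := by simp [phi, Yr]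
theorem jm_X : (jm X1 : Ar G) = Xr := by simp [jm, X1]
theorem jm_Y : (jm Y1 : Ar G) = Yr 1 := by simp [jm, Y1]
theorem kap_X (s : G) : kap s X1 = Xr := by simp [kap, X1]
theorem kap_Y (s : G) : kap s Y1 = Yr s := by simp [kap, Y1]
theorem alp_X (s : G) : alp s X1 = zdel s := by simp [alp, X1]
theorem alp_Y (s : G) : alp s Y1 = zet - zdel s := by simp [alp, Y1]
theorem phi1_X : phi1 X1 = X1 + Y1 := by simp [phi1, X1]
theorem phi1_Y : phi1 Y1 = - Y1 := by simp [phi1, Y1]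

theorem jm_mul_z (a : A1) : (jm (a * (X1 + Y1)) : Ar G) = jm a * zet := by
  rw [map_mul, map_add, jm_X, jm_Y, zet]
theorem alp_mul_z (s : G) (a : A1) : alp s (a * (X1 + Y1)) = alp s a * zet := by
  rw [map_mul, map_add, alp_X, alp_Y, add_sub_cancel]
theorem alp_mul_Y (s : G) (a : A1) : alp s (a * Y1) = alp s a * (zet - zdel s) := by
  rw [map_mul, alp_Y]

theorem homA {B : Type} [Ring B] [Algebra ℚ B] (f g : A1 →ₐ[ℚ] B) (hx : f X1 = g X1)
    (hy : f Y1 = g Y1) (a : A1) : f a = g a := by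
  have : f = g := by
    apply FreeAlgebra.hom_ext
    funext l
    cases l with
    | x => exact hx
    | y => exact hy
  rw [this]

theorem phi_jm (a : A1) : (phi (jm a) : Ar G) = jm (phi1 a) :=
  homA ((phi (G := G)).comp jm) (jm.comp phi1)
    (by simp [jm_X, phi_X, phi1_X, zet, jm_Y])
    (by simp [jm_Y, phi_Y, phi1_Y, zet, zdel_one]) a

theorem phi_kap (s : G) (a : A1) : phi (kap s (phi1 a)) = alp s a :=
  homA (((phi (G := G)).comp (kap s)).comp phi1) (alp s)
    (by simp [kap_X, kap_Y, phi_X, phi_Y, phi1_X, alp_X])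
    (by simp [kap_Y, phi_Y, phi1_Y, alp_Y]) a

theorem alp_one (a : A1) : alp (1 : G) a = jm a :=
  homA (alp (1 : G)) jm (by simp [alp_X, jm_X, zdel_one])
    (by simp [alp_Y, jm_Y, zdel_one, zet]) a

theorem jm_inj : Function.Injective (jm : A1 → Ar G) := by
  let q : Ar G →ₐ[ℚ] A1 := lift ℚ (fun l => match l with
    | LetR.x => X1
    | LetR.y _ => Y1)
  have h : ∀ a, q (jm a) = a := fun a =>
    homA (q.comp jm) (AlgHom.id ℚ A1) (by simp [jm_X, q, Xr]) (by simp [jm_Y, q, Yr]) a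
  exact Function.LeftInverse.injective h

theorem cumul_const (s : G) (L : List ℕ) :
    cumul s (L.map (fun n => (n, (1 : G)))) = L.map (fun n => (n, s)) := by
  induction L with
  | nil => rfl
  | cons n L ih => simp [cumul, ih]

theorem wordP_snoc (L : List ℕ) (s : G) (a : ℕ) :
    wordP ((L ++ [a]).map (fun n => (n, s))) =
      wordP (L.map (fun n => (n, s))) * (Xr ^ a * Yr s) := by
  simp [wordP]

theorem kap_span (a : A1) : a ∈ Submodule.span ℚ {b : A1 | ∃ (L : List ℕ) (n : ℕ),
    ∀ s : G, kap s b = wordP (L.map (fun n => (n, s))) * Xr ^ n} := by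
  refine peelR _ ?_ ?_ ?_ ?_ a
  · exact Submodule.subset_span ⟨[], 0, by simp [wordP]⟩
  · intro a b ha hb; exact add_mem ha hb
  · intro c a ha; exact Submodule.smul_mem _ _ ha
  · intro a l ha
    induction ha using Submodule.span_induction with
    | zero => simp
    | add x y _ _ hx hy => rw [add_mul]; exact add_mem hx hy
    | smul c x _ hx => rw [smul_mul_assoc]; exact Submodule.smul_mem _ _ hx
    | mem x hx =>
      obtain ⟨L, n, h⟩ := hx
      apply Submodule.subset_span
      cases l with
      | x =>
        refine ⟨L, n + 1, fun s => ?_⟩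
        change kap s (x * X1) = _
        rw [map_mul, h, kap_X, pow_succ, mul_assoc]
      | y =>
        refine ⟨L ++ [n], 0, fun s => ?_⟩
        change kap s (x * Y1) = _
        rw [map_mul, h, kap_Y, wordP_snoc, pow_zero, mul_one, mul_assoc]

theorem jm_eq_kap (a : A1) : (jm a : Ar G) = kap 1 a :=
  homA jm (kap (1 : G)) (by rw [jm_X, kap_X]) (by rw [jm_Y, kap_Y]) a

theorem psi_jm (ds : DiamondSetup G) (s : G) (a : A1) : ds.psi s (jm a) = phi (kap s a) := by
  have ha := kap_span (G := G) a
  induction ha using Submodule.span_induction with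
  | zero => simp
  | add x y _ _ hx hy => simp only [map_add, hx, hy]
  | smul c x _ hx => simp only [map_smul, hx]
  | mem x hx =>
    obtain ⟨L, n, h⟩ := hx
    rw [jm_eq_kap, h, h, ds.psi_spec, cumul_const]

theorem D_one' (ds : DiamondSetup G) (s : G) (a : A1) : ds.D s a 1 = alp s a := by
  rw [ds.D_one, phi_jm, psi_jm, phi_kap]

theorem D_zl (ds : DiamondSetup G) (s : G) (v : A1) (w : Ar G) :
    ds.D s (v * (X1 + Y1)) w = ds.D s v w * zet := by
  refine peelR (fun w => ds.D s (v * (X1 + Y1)) w = ds.D s v w * zet) ?_ ?_ ?_ ?_ w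
  · simp [D_one', alp_X, alp_Y]
  · intro a b ha hb; simp only [map_add, ha, hb, add_mul]
  · intro c a ha; simp only [map_smul, ha, smul_mul_assoc]
  · intro w l _
    cases l with
    | x =>
      change ds.D s (v * (X1 + Y1)) (w * Xr) = ds.D s v (w * Xr) * zet
      rw [mul_add, map_add, LinearMap.add_apply, ds.Dxx, ds.Dyx, zet]
      noncomm_ring
    | y t =>
      change ds.D s (v * (X1 + Y1)) (w * Yr t) = ds.D s v (w * Yr t) * zet
      rw [mul_add, map_add, LinearMap.add_apply]
      by_cases ht : t = 1
      · subst ht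
        rw [ds.Dxy, ds.Dyy, zet]
        noncomm_ring
      · rw [ds.Dxyt s t ht, ds.Dyyt s t ht, zet, mul_add (ds.D s v (w * Yr t))]
        abel

theorem D_zr (ds : DiamondSetup G) (s : G) (v : A1) (w : Ar G) :
    ds.D s v (w * zet) = ds.D s v w * zet := by
  refine peelA (fun v => ds.D s v (w * zet) = ds.D s v w * zet) ?_ ?_ ?_ ?_ ?_ v
  · simp [ds.one_D]
  · intro a b ha hb; simp only [map_add, LinearMap.add_apply, ha, hb, add_mul]
  · intro c a ha; simp only [map_smul, LinearMap.smul_apply, ha, smul_mul_assoc]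
  · intro a ha; rw [D_zl, D_zl, ha]
  · intro v hv
    have h1 : ds.D s (v * X1) w = ds.D s v w * zet - ds.D s (v * Y1) w := by
      rw [← D_zl, mul_add, map_add, LinearMap.add_apply]; abel
    have h2 : ds.D s (v * Y1) (w * zet) = ds.D s v (w * zet) * Yr 1 + ds.D s (v * Y1) w * Xr
        - ds.D s (v * X1) w * Yr 1 := by
      rw [zet, mul_add, map_add, ds.Dyx, ds.Dyy, map_add, add_mul]; abel
    rw [h2, hv, h1, zet]
    noncomm_ring

theorem D_yd (ds : DiamondSetup G) (s t : G) (v : A1) (w : Ar G) :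
    ds.D s (v * Y1) (w * zdel t) =
      ds.D s v (w * zdel t) * (zet - zdel t) + ds.D s (v * Y1) w * zdel t := by
  by_cases ht : t = 1
  · subst ht
    rw [zdel_one, ds.Dyx, zet, add_sub_cancel_left]
  · rw [zdel_ne ht, mul_add, map_add, ds.Dyx, ds.Dyyt s t ht, zet, mul_add w, map_add]
    noncomm_ring

theorem D1_zl (ds : DiamondSetup G) (u v : A1) :
    ds.D1 (u * (X1 + Y1)) v = ds.D1 u v * (X1 + Y1) := by
  apply jm_inj (G := G)
  rw [ds.D1_spec, D_zl, map_mul, ds.D1_spec, map_add, jm_X, jm_Y, zet]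

theorem D1_zr (ds : DiamondSetup G) (u v : A1) :
    ds.D1 u (v * (X1 + Y1)) = ds.D1 u v * (X1 + Y1) := by
  apply jm_inj (G := G)
  rw [ds.D1_spec, jm_mul_z, jm_mul_z, D_zr, ds.D1_spec]

theorem D1_yx (ds : DiamondSetup G) (u v : A1) :
    ds.D1 (u * Y1) (v * X1) = ds.D1 u (v * X1) * Y1 + ds.D1 (u * Y1) v * X1 := by
  apply jm_inj (G := G)
  simp only [ds.D1_spec, map_mul, map_add, jm_X, jm_Y, ds.Dyx]

theorem D1_yy (ds : DiamondSetup G) (u v : A1) :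
    ds.D1 (u * Y1) (v * Y1) = ds.D1 (u * Y1) v * Y1 + ds.D1 u (v * Y1) * Y1
      - ds.D1 u v * (X1 + Y1) * Y1 := by
  have h1 : ds.D1 (u * Y1) (v * Y1) = ds.D1 (u * Y1) (v * (X1 + Y1))
      - ds.D1 (u * Y1) (v * X1) := by rw [mul_add, map_add]; abel
  have h2 : ds.D1 u (v * X1) = ds.D1 u (v * (X1 + Y1)) - ds.D1 u (v * Y1) := by
    rw [mul_add, map_add]; abel
  rw [h1, D1_yx, h2, D1_zr, D1_zr]
  noncomm_ring

theorem D1_one (ds : DiamondSetup G) (u : A1) : ds.D1 u 1 = u := by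
  apply jm_inj (G := G)
  rw [ds.D1_spec, map_one, D_one', alp_one]

theorem one_D1 (ds : DiamondSetup G) (u : A1) : ds.D1 1 u = u := by
  apply jm_inj (G := G)
  rw [ds.D1_spec, ds.one_D]

/-- `a ⋄ (q (z - z^δ))`. -/
theorem D_yeta (ds : DiamondSetup G) (s t : G) (v : A1) (q : Ar G) :
    ds.D s (v * Y1) (q * (zet - zdel t)) =
      ds.D s (v * Y1) q * (zet - zdel t) - ds.D s v q * zet * (zet - zdel t)
        + ds.D s v (q * (zet - zdel t)) * (zet - zdel t) := by
  simp only [mul_sub q, map_sub, D_yd, D_zr]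
  noncomm_ring

theorem alp_D1 (ds : DiamondSetup G) (s : G) (u v : A1) :
    alp s (ds.D1 u v) = ds.D s u (alp s v) := by
  revert v
  refine peelA (fun u => ∀ v, alp s (ds.D1 u v) = ds.D s u (alp s v)) ?_ ?_ ?_ ?_ ?_ u
  · intro v; rw [one_D1, ds.one_D]
  · intro a b ha hb v; simp only [map_add, LinearMap.add_apply, ha, hb]
  · intro c a ha v; simp only [map_smul, LinearMap.smul_apply, ha]
  · intro a ha v
    rw [D1_zl, D_zl, map_mul, ha, map_add, alp_X, alp_Y, add_sub_cancel]
  · intro u hu v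
    refine peelA (fun v => alp s (ds.D1 (u * Y1) v) = ds.D s (u * Y1) (alp s v))
      ?_ ?_ ?_ ?_ ?_ v
    · rw [D1_one, map_one, D_one']
    · intro a b ha hb; simp only [map_add, ha, hb]
    · intro c a ha; simp only [map_smul, ha]
    · intro a ha
      rw [D1_zr, alp_mul_z, ha, alp_mul_z, D_zr]
    · intro v hv
      rw [D1_yy, map_sub, map_add]
      simp only [alp_mul_Y, alp_mul_z, hv, hu, D_yeta]
      abel

theorem D_assoc (ds : DiamondSetup G) (s : G) (u v : A1) (w : Ar G) :
    ds.D s (ds.D1 u v) w = ds.D s u (ds.D s v w) := by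
  revert v w
  refine peelA (fun u => ∀ v w, ds.D s (ds.D1 u v) w = ds.D s u (ds.D s v w)) ?_ ?_ ?_ ?_ ?_ u
  · intro v w; rw [one_D1, ds.one_D]
  · intro a b ha hb v w; simp only [map_add, LinearMap.add_apply, ha, hb]
  · intro c a ha v w; simp only [map_smul, LinearMap.smul_apply, ha]
  · intro a ha v w
    rw [D1_zl, D_zl, D_zl, ha]
  · intro u hu v
    refine peelA (fun v => ∀ w, ds.D s (ds.D1 (u * Y1) v) w = ds.D s (u * Y1) (ds.D s v w))
      ?_ ?_ ?_ ?_ ?_ v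
    · intro w; rw [D1_one, ds.one_D]
    · intro a b ha hb w; simp only [map_add, LinearMap.add_apply, ha, hb]
    · intro c a ha w; simp only [map_smul, LinearMap.smul_apply, ha]
    · intro a ha w
      rw [D1_zr, D_zl, D_zl, D_zr, ha]
    · intro v hv w
      refine peelG (fun w => ds.D s (ds.D1 (u * Y1) (v * Y1)) w =
        ds.D s (u * Y1) (ds.D s (v * Y1) w)) ?_ ?_ ?_ ?_ ?_ w
      · rw [D_one', D_one', alp_D1]
      · intro a b ha hb; simp only [map_add, ha, hb]
      · intro c a ha; simp only [map_smul, ha]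
      · intro a ha; simp only [D_zr, ha]
      · intro w t hw
        have e1 : ds.D s (ds.D1 (u * Y1) (v * Y1)) (w * zdel t) =
            ds.D s (ds.D1 (u * Y1) v) (w * zdel t) * (zet - zdel t)
            + ds.D s (ds.D1 u (v * Y1)) (w * zdel t) * (zet - zdel t)
            - ds.D s (ds.D1 u v) (w * zdel t) * zet * (zet - zdel t)
            + ds.D s (ds.D1 (u * Y1) (v * Y1)) w * zdel t := by
          rw [D1_yy]
          simp only [map_sub, map_add, LinearMap.sub_apply, LinearMap.add_apply, D_yd, D_zl]
          noncomm_ring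
        rw [e1, hw, hv, hu, hu, D_yd ds s t v w, map_add, map_add, D_yeta,
          D_yd ds s t u (ds.D s (v * Y1) w)]
        noncomm_ring

open TensorProduct

variable {H : Type} [CommRing H] [HopfAlgebra ℚ H]

/-- `(a ⊗ b) ↦ (F_a ⋄_s v) z_t^δ (N_b ⋄_t w)`. -/
noncomputable def QN (C : CKSetup G H) (s t : G) (v w : Ar G) (N : H →ₗ[ℚ] A1) :
    H ⊗[ℚ] H →ₗ[ℚ] Ar G :=
  TensorProduct.lift
    (((LinearMap.mul ℚ (Ar G)).compl₂ (((C.ds.D t).flip w).comp N)).comp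
      ((LinearMap.mulRight ℚ (zdel t)).comp (((C.ds.D s).flip v).comp C.F)))

theorem QN_tmul (C : CKSetup G H) (s t : G) (v w : Ar G) (N : H →ₗ[ℚ] A1) (a b : H) :
    QN C s t v w N (a ⊗ₜ b) = C.ds.D s (C.F a) v * zdel t * C.ds.D t (N b) w := by
  simp [QN]

theorem exists_U (C : CKSetup G H) : ∃ U : H →ₗ[ℚ] A1, ∀ h : H,
    C.F h = U h * Y1 + Coalgebra.counit (R := ℚ) h • (1 : A1) := by
  have hY : Y1 ≠ 0 := FreeAlgebra.ι_ne_zero _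
  obtain ⟨g, hg⟩ := LinearMap.exists_leftInverse_of_injective (LinearMap.mulRight ℚ Y1) (by
    rw [LinearMap.ker_eq_bot]
    exact mul_left_injective₀ hY)
  let q : H →ₗ[ℚ] H := LinearMap.id -
    (LinearMap.toSpanSingleton ℚ H 1).comp (Coalgebra.counit (R := ℚ) (A := H))
  have hq : ∀ h, q h = h - Coalgebra.counit (R := ℚ) h • (1 : H) := by
    intro h; simp [q]
  refine ⟨g.comp (C.F.comp q), fun h => ?_⟩
  obtain ⟨u, hu⟩ := C.F_ends (q h) (by rw [hq]; simp)
  have h1 : g (u * Y1) = u := by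
    have := LinearMap.congr_fun hg u
    simpa using this
  have h2 : C.F (q h) = C.F h - Coalgebra.counit (R := ℚ) h • (1 : A1) := by
    rw [hq, map_sub, map_smul, C.F_one]
  simp only [LinearMap.comp_apply]
  rw [hu, h1, ← hu, h2]
  abel

theorem F_Bp (C : CKSetup G H) (U : H →ₗ[ℚ] A1) (hU : ∀ h : H,
    C.F h = U h * Y1 + Coalgebra.counit (R := ℚ) h • (1 : A1)) (h : H) :
    C.F (C.Bp h) = (U h * (X1 + Y1) + C.F h) * Y1 := by
  have e0 : C.F (h - Coalgebra.counit (R := ℚ) h • (1 : H)) = U h * Y1 := by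
    rw [map_sub, map_smul, C.F_one, hU]; abel
  have e1 := C.F_graft (h - Coalgebra.counit (R := ℚ) h • (1 : H)) (by simp) _ e0
  rw [map_sub, map_smul, map_sub, map_smul, C.F_dot, sub_eq_iff_eq_add] at e1
  rw [e1, hU, two_smul]
  simp only [add_mul, mul_add, smul_mul_assoc, one_mul]
  abel

theorem DU (C : CKSetup G H) (U : H →ₗ[ℚ] A1) (hU : ∀ h : H,
    C.F h = U h * Y1 + Coalgebra.counit (R := ℚ) h • (1 : A1))
    (s t : G) (h : H) (w : Ar G) :
    C.ds.D s (U h) (w * zdel t) * (zet - zdel t) =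
      C.ds.D s (C.F h) (w * zdel t) - C.ds.D s (C.F h) w * zdel t := by
  rw [hU]
  simp only [map_add, map_smul, LinearMap.add_apply, LinearMap.smul_apply, C.ds.one_D, D_yd,
    add_mul, smul_mul_assoc]
  abel

theorem DFB (C : CKSetup G H) (U : H →ₗ[ℚ] A1) (hU : ∀ h : H,
    C.F h = U h * Y1 + Coalgebra.counit (R := ℚ) h • (1 : A1))
    (s t : G) (h : H) (w : Ar G) :
    C.ds.D s (C.F (C.Bp h)) (w * zdel t) =
      (C.ds.D s (U h) (w * zdel t) * zet + C.ds.D s (C.F h) (w * zdel t)) * (zet - zdel t)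
        + C.ds.D s (C.F (C.Bp h)) w * zdel t := by
  rw [F_Bp C U hU, D_yd, map_add, LinearMap.add_apply, D_zl]

theorem DFB1 (C : CKSetup G H) (U : H →ₗ[ℚ] A1) (hU : ∀ h : H,
    C.F h = U h * Y1 + Coalgebra.counit (R := ℚ) h • (1 : A1))
    (s : G) (h : H) :
    C.ds.D s (C.F (C.Bp h)) 1 =
      (C.ds.D s (U h) 1 * zet + C.ds.D s (C.F h) 1) * (zet - zdel s) := by
  simp only [D_one']
  rw [F_Bp C U hU, alp_mul_Y, map_add, alp_mul_z]

theorem QU (C : CKSetup G H) (U : H →ₗ[ℚ] A1) (hU : ∀ h : H,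
    C.F h = U h * Y1 + Coalgebra.counit (R := ℚ) h • (1 : A1))
    (s s' t : G) (v w : Ar G) (x : H ⊗[ℚ] H) :
    QN C s s' v (w * zdel t) U x * (zet - zdel t) =
      QN C s s' v (w * zdel t) C.F x - QN C s s' v w C.F x * zdel t := by
  induction x using TensorProduct.induction_on with
  | zero => simp
  | add x y hx hy => simp only [map_add, add_mul, hx, hy]; abel
  | tmul a b =>
    simp only [QN_tmul]
    rw [mul_assoc, DU C U hU, mul_sub, ← mul_assoc]

theorem QU1 (C : CKSetup G H) (U : H →ₗ[ℚ] A1) (hU : ∀ h : H,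
    C.F h = U h * Y1 + Coalgebra.counit (R := ℚ) h • (1 : A1))
    (s s' : G) (v : Ar G) (x : H ⊗[ℚ] H) :
    QN C s s' v 1 U x * (zet - zdel s') = QN C s s' v 1 C.F x -
      C.ds.D s (C.F (TensorProduct.rid ℚ H
        ((Coalgebra.counit (R := ℚ) (A := H)).lTensor H x))) v * zdel s' := by
  induction x using TensorProduct.induction_on with
  | zero => simp
  | add x y hx hy => simp only [map_add, add_mul, LinearMap.add_apply, hx, hy]; abel
  | tmul a b =>
    simp only [QN_tmul, LinearMap.lTensor_tmul, TensorProduct.rid_tmul, D_one', map_smul,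
      LinearMap.smul_apply]
    rw [hU b, map_add, alp_mul_Y, map_smul, map_one, mul_add, mul_smul_comm, mul_one,
      smul_mul_assoc, mul_assoc _ (alp s' (U b))]
    abel

theorem QFB (C : CKSetup G H) (U : H →ₗ[ℚ] A1) (hU : ∀ h : H,
    C.F h = U h * Y1 + Coalgebra.counit (R := ℚ) h • (1 : A1))
    (s s' t : G) (v w : Ar G) (x : H ⊗[ℚ] H) :
    QN C s s' v (w * zdel t) (C.F.comp C.Bp) x =
      (QN C s s' v (w * zdel t) U x * zet + QN C s s' v (w * zdel t) C.F x) * (zet - zdel t)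
        + QN C s s' v w (C.F.comp C.Bp) x * zdel t := by
  induction x using TensorProduct.induction_on with
  | zero => simp
  | add x y hx hy => simp only [map_add, add_mul, hx, hy]; abel
  | tmul a b =>
    simp only [QN_tmul, LinearMap.comp_apply]
    rw [DFB C U hU]
    simp only [mul_add, add_mul, mul_assoc]

theorem QFB1 (C : CKSetup G H) (U : H →ₗ[ℚ] A1) (hU : ∀ h : H,
    C.F h = U h * Y1 + Coalgebra.counit (R := ℚ) h • (1 : A1))
    (s s' : G) (v : Ar G) (x : H ⊗[ℚ] H) :
    QN C s s' v 1 (C.F.comp C.Bp) x =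
      (QN C s s' v 1 U x * zet + QN C s s' v 1 C.F x) * (zet - zdel s') := by
  induction x using TensorProduct.induction_on with
  | zero => simp
  | add x y hx hy => simp only [map_add, add_mul, hx, hy]; abel
  | tmul a b =>
    simp only [QN_tmul, LinearMap.comp_apply]
    rw [DFB1 C U hU]
    simp only [mul_add, add_mul, mul_assoc]

theorem Q_wz (C : CKSetup G H) (s s' : G) (v w : Ar G) (N : H →ₗ[ℚ] A1) (x : H ⊗[ℚ] H) :
    QN C s s' v (w * zet) N x = QN C s s' v w N x * zet := by
  induction x using TensorProduct.induction_on with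
  | zero => simp
  | add x y hx hy => simp only [map_add, add_mul, hx, hy]
  | tmul a b => simp only [QN_tmul, D_zr, mul_assoc]

theorem Q_wadd (C : CKSetup G H) (s s' : G) (v w w' : Ar G) (N : H →ₗ[ℚ] A1) (x : H ⊗[ℚ] H) :
    QN C s s' v (w + w') N x = QN C s s' v w N x + QN C s s' v w' N x := by
  induction x using TensorProduct.induction_on with
  | zero => simp
  | add x y hx hy => simp only [map_add, hx, hy]; abel
  | tmul a b => simp only [QN_tmul, map_add, mul_add]

theorem Q_wsmul (C : CKSetup G H) (s s' : G) (v w : Ar G) (c : ℚ) (N : H →ₗ[ℚ] A1)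
    (x : H ⊗[ℚ] H) :
    QN C s s' v (c • w) N x = c • QN C s s' v w N x := by
  induction x using TensorProduct.induction_on with
  | zero => simp
  | add x y hx hy => simp only [map_add, hx, hy, smul_add]
  | tmul a b => simp only [QN_tmul, map_smul, mul_smul_comm]

theorem Q_map (C : CKSetup G H) (s s' : G) (v w : Ar G) (x : H ⊗[ℚ] H) :
    QN C s s' v w C.F (TensorProduct.map LinearMap.id C.Bp x) =
      QN C s s' v w (C.F.comp C.Bp) x := by
  induction x using TensorProduct.induction_on with
  | zero => simp
  | add x y hx hy => simp only [map_add, hx, hy]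
  | tmul a b => simp only [QN_tmul, TensorProduct.map_tmul, LinearMap.comp_apply, LinearMap.id_apply]

/-- The claim for one forest. -/
def Cl (C : CKSetup G H) (f : H) : Prop := ∀ (s s' : G) (v w : Ar G),
  C.ds.D s (C.F f) (v * zdel s' * w) = QN C s s' v w C.F (Coalgebra.comul (R := ℚ) f)

theorem Cl_one (C : CKSetup G H) : Cl C 1 := by
  intro s s' v w
  rw [Bialgebra.comul_one, Algebra.TensorProduct.one_def, QN_tmul, C.F_one]
  simp only [C.ds.one_D]

theorem Cl_mul (C : CKSetup G H) (g h : H) (hg : Cl C g) (hh : Cl C h) : Cl C (g * h) := by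
  intro s s' v w
  rw [C.F_mul, D_assoc, hh, Bialgebra.comul_mul]
  generalize Coalgebra.comul (R := ℚ) h = y
  induction y using TensorProduct.induction_on with
  | zero => simp
  | add x y hx hy => simp only [map_add, hx, hy, mul_add]
  | tmul a b =>
    rw [QN_tmul, hg]
    generalize Coalgebra.comul (R := ℚ) g = x
    induction x using TensorProduct.induction_on with
    | zero => simp
    | add x y hx hy => simp only [map_add, hx, hy, add_mul]
    | tmul c d =>
      rw [Algebra.TensorProduct.tmul_mul_tmul]
      simp only [QN_tmul, C.F_mul, D_assoc]

theorem Cl_Bp (C : CKSetup G H) (f : H) (hf : Cl C f) : Cl C (C.Bp f) := by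
  obtain ⟨U, hU⟩ := exists_U C
  intro s s' v w
  rw [C.Bp_cocycle, map_add, QN_tmul, C.F_one, C.ds.one_D, Q_map]
  refine peelG (fun w => C.ds.D s (C.F (C.Bp f)) (v * zdel s' * w) =
    C.ds.D s (C.F (C.Bp f)) v * zdel s' * w +
      QN C s s' v w (C.F.comp C.Bp) (Coalgebra.comul (R := ℚ) f)) ?_ ?_ ?_ ?_ ?_ w
  · have e : C.ds.D s (U f) (v * zdel s') =
        QN C s s' v 1 U (Coalgebra.comul (R := ℚ) f) := by
      apply mul_right_cancel₀ (zet_sub_zdel_ne s')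
      rw [DU C U hU, QU1 C U hU, ← hf, mul_one, Coalgebra.lTensor_counit_comul,
        TensorProduct.rid_tmul, one_smul]
    rw [mul_one, mul_one, QFB1 C U hU, DFB C U hU, e, ← hf, mul_one]
    abel
  · intro a b ha hb
    simp only [mul_add, map_add, ha, hb, Q_wadd]; abel
  · intro c a ha
    simp only [mul_smul_comm, map_smul, ha, Q_wsmul, smul_add]
  · intro a ha
    rw [← mul_assoc, D_zr, ha, Q_wz, add_mul, mul_assoc _ a]
  · intro w t hw
    have e : C.ds.D s (U f) (v * zdel s' * w * zdel t) =
        QN C s s' v (w * zdel t) U (Coalgebra.comul (R := ℚ) f) := by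
      apply mul_right_cancel₀ (zet_sub_zdel_ne t)
      rw [DU C U hU, QU C U hU, ← hf, ← hf, mul_assoc _ w]
    rw [← mul_assoc, DFB C U hU, hw, e, QFB C U hU, ← hf, add_mul _ _ (zdel t), ← mul_assoc,
      ← mul_assoc]
    abel

end Helpers

open TensorProduct in
/-- For `f ∈ H` with `Δ(f) = Σ f' ⊗ f''`, for all `s, s' ∈ μ_r` and `v, w ∈ A_r`:
`F_f ⋄_s (v z_{s'}^δ w) = Σ (F_{f'} ⋄_s v) z_{s'}^δ (F_{f''} ⋄_{s'} w)`. -/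
theorem statement7 {G : Type} [CommGroup G] {H : Type} [CommRing H] [HopfAlgebra ℚ H]
    (C : CKSetup G H) (f : H) (s s' : G) (v w : Ar G) :
    C.ds.D s (C.F f) (v * zdel s' * w) =
      TensorProduct.lift
        (((LinearMap.mul ℚ (Ar G)).compl₂ (((C.ds.D s').flip w).comp C.F)).comp
          ((LinearMap.mulRight ℚ (zdel s')).comp (((C.ds.D s).flip v).comp C.F)))
        (Coalgebra.comul (R := ℚ) f) := by
  refine C.hgen
    { carrier := {f | Cl C f}
      add_mem' := ?_
      zero_mem' := ?_
      smul_mem' := ?_ } (Cl_one C) (Cl_mul C) (Cl_Bp C) f s s' v w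
  · intro a b ha hb s s' v w
    simp only [map_add, LinearMap.add_apply, ha s s' v w, hb s s' v w]
  · intro s s' v w
    simp
  · intro c a ha s s' v w
    simp only [map_smul, LinearMap.smul_apply, ha s s' v w]
end

section
/- Let S be the antipode of the Connes–Kreimer Hopf algebra H and f ∈ Aug(H) with Δ(f) = Σ f' ⊗ f''. Then Σ F_{f'} ⋄_1 G_{f''} = 0 in A_1, where F and G are the polynomials attached to rooted forests (G_f = F_{S(f)}). -/
open FreeAlgebra

variable {G : Type} [CommGroup G]

namespace RTM
open Coalgebra WithConv

section conv
variable {H A : Type} [CommRing H] [HopfAlgebra ℚ H] [Ring A] [Algebra ℚ A]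

/-- Constant maps in the convolution algebra. -/
noncomputable def cst (a : A) : WithConv (H →ₗ[ℚ] A) :=
  toConv (LinearMap.toSpanSingleton ℚ A a ∘ₗ counit)

theorem cst_apply (a : A) (f : H) :
    (cst a : WithConv (H →ₗ[ℚ] A)) f = counit (R := ℚ) f • a := rfl

theorem cst_mul (a : A) (φ : WithConv (H →ₗ[ℚ] A)) (f : H) :
    (cst a * φ : WithConv (H →ₗ[ℚ] A)) f = a * φ f := by
  rw [(ℛ ℚ f).convMul_apply]
  conv_rhs => rw [← sum_counit_smul (ℛ ℚ f)]
  rw [map_sum, Finset.mul_sum]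
  refine Finset.sum_congr rfl fun i _ => ?_
  rw [cst_apply, map_smul, smul_mul_assoc, mul_smul_comm]

theorem mul_cst (a : A) (φ : WithConv (H →ₗ[ℚ] A)) (f : H) :
    (φ * cst a : WithConv (H →ₗ[ℚ] A)) f = φ f * a := by
  rw [(ℛ ℚ f).convMul_apply]
  have h : ∑ i ∈ (ℛ ℚ f).index, counit (R := ℚ) ((ℛ ℚ f).right i) • (ℛ ℚ f).left i = f := by
    have := congrArg (TensorProduct.rid ℚ H) (sum_tmul_counit_eq (ℛ ℚ f))
    simpa only [map_sum, TensorProduct.rid_tmul, one_smul] using this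
  conv_rhs => rw [← h]
  rw [map_sum, Finset.sum_mul]
  refine Finset.sum_congr rfl fun i _ => ?_
  rw [cst_apply, map_smul, smul_mul_assoc, mul_smul_comm]

theorem conv_ext {φ ψ : WithConv (H →ₗ[ℚ] A)} (h : ∀ f, φ f = ψ f) : φ = ψ :=
  WithConv.ext (LinearMap.ext h)

open TensorProduct in
theorem conv_Bp (Bp : H →ₗ[ℚ] H) (hB : ∀ f : H, Coalgebra.comul (R := ℚ) (Bp f) =
      (Bp f) ⊗ₜ[ℚ] (1 : H) + (TensorProduct.map LinearMap.id Bp) (Coalgebra.comul (R := ℚ) f))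
    (φ ψ : WithConv (H →ₗ[ℚ] A)) (f : H) :
    (φ * ψ) (Bp f) = φ (Bp f) * ψ 1 + (φ * toConv (ψ.ofConv ∘ₗ Bp)) f := by
  rw [(ℛ ℚ f).convMul_apply, LinearMap.convMul_apply, hB, ← (ℛ ℚ f).eq]
  simp

theorem conv_antipode (T : H →ₐ[ℚ] A) :
    toConv T.toLinearMap * toConv (T.toLinearMap ∘ₗ HopfAlgebra.antipode ℚ) = 1 := by
  refine conv_ext fun f => ?_
  rw [(ℛ ℚ f).convMul_apply, LinearMap.convOne_apply]
  have := congrArg T (HopfAlgebra.sum_mul_antipode_eq_algebraMap_counit (ℛ ℚ f))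
  simpa using this

theorem antipode_conv (T : H →ₐ[ℚ] A) :
    toConv (T.toLinearMap ∘ₗ HopfAlgebra.antipode ℚ) * toConv T.toLinearMap = 1 := by
  refine conv_ext fun f => ?_
  rw [(ℛ ℚ f).convMul_apply, LinearMap.convOne_apply]
  have := congrArg T (HopfAlgebra.sum_antipode_mul_eq_algebraMap_counit (ℛ ℚ f))
  simpa using this

theorem conv_mul_mul (T E : WithConv (H →ₗ[ℚ] A)) (hT : ∀ a b, T (a * b) = T a * T b)
    (hE : ∀ a b, E (a * b) = E a * E b) (f g : H) :
    (T * E) (f * g) = (T * cst ((T * E) f) * E : WithConv (H →ₗ[ℚ] A)) g := by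
  rw [((ℛ ℚ f).mul (ℛ ℚ g)).convMul_apply, (ℛ ℚ g).convMul_apply]
  simp_rw [mul_cst]
  rw [(ℛ ℚ f).convMul_apply]
  simp only [Finset.mul_sum, Finset.sum_mul]
  rw [Finset.sum_comm]
  simp [Finset.sum_product, hE, mul_assoc]
  refine Finset.sum_congr rfl fun i _ => Finset.sum_congr rfl fun j _ => ?_
  rw [mul_comm, hT, mul_assoc]

end conv

theorem free_ind {X : Type} (P : Submodule ℚ (FreeAlgebra ℚ X)) (h1 : (1 : FreeAlgebra ℚ X) ∈ P)
    (hm : ∀ a ∈ P, ∀ i, a * FreeAlgebra.ι ℚ i ∈ P) (a : FreeAlgebra ℚ X) : a ∈ P := by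
  suffices h : ∀ b, ∀ a ∈ P, a * b ∈ P by simpa using h a 1 h1
  intro b
  induction b using FreeAlgebra.induction with
  | grade0 r => intro a ha; rw [← Algebra.commutes, ← Algebra.smul_def]; exact P.smul_mem _ ha
  | grade1 x => intro a ha; exact hm a ha x
  | mul b c hb hc => intro a ha; rw [← mul_assoc]; exact hc _ (hb _ ha)
  | add b c hb hc => intro a ha; rw [mul_add]; exact P.add_mem (hb _ ha) (hc _ ha)

/-- Induction for `A1` with letters `z = x + y` and `x`. -/
theorem A1_ind (P : A1 → Prop) (h1 : P 1) (hadd : ∀ a b, P a → P b → P (a + b))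
    (hs : ∀ (c : ℚ) a, P a → P (c • a)) (hz : ∀ a, P a → P (a * (X1 + Y1)))
    (hy : ∀ a, P a → P (a * Y1)) (a : A1) : P a := by
  let Q : Submodule ℚ A1 :=
    { carrier := {a | P a}
      add_mem' := fun {a b} ha hb => hadd a b ha hb
      zero_mem' := by have := hs 0 1 h1; rwa [zero_smul] at this
      smul_mem' := fun c a ha => hs c a ha }
  refine free_ind Q h1 ?_ a
  rintro a ha (_ | _)
  · have := hadd _ _ (hz a ha) (hs (-1) _ (hy a ha))
    change P (a * X1)
    convert this using 1
    rw [neg_one_smul]; noncomm_ring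
  · exact hy a ha

section diamond
variable {G : Type} [CommGroup G] (ds : DiamondSetup G)

/-- a left inverse of `jm` -/
noncomputable def jinv : Ar G →ₐ[ℚ] A1 :=
  FreeAlgebra.lift ℚ (fun l => match l with
    | LetR.x => X1
    | LetR.y _ => Y1)

theorem jm_X : (jm X1 : Ar G) = Xr := by simp [jm, X1]
theorem jm_Y : (jm Y1 : Ar G) = Yr 1 := by simp [jm, Y1]

theorem jinv_jm (a : A1) : jinv (jm a : Ar G) = a := by
  have : (jinv (G := G)).comp jm = AlgHom.id ℚ A1 := by
    ext l
    cases l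
    · change jinv (jm X1 : Ar G) = X1
      rw [jm_X]; simp [jinv, Xr]
    · change jinv (jm Y1 : Ar G) = Y1
      rw [jm_Y]; simp [jinv, Yr]
  exact DFunLike.congr_fun this a

theorem jm_inj : Function.Injective (jm : A1 →ₐ[ℚ] Ar G) :=
  Function.LeftInverse.injective jinv_jm

theorem phi_X : phi (Xr : Ar G) = Xr + Yr 1 := by simp [phi, Xr, zet]
theorem phi_Y : phi (Yr 1 : Ar G) = - Yr 1 := by
  simp [phi, Yr, zet, zdel]

theorem phi_phi_jm (a : A1) : phi (phi (jm a : Ar G)) = jm a := by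
  have : ((phi (G := G)).comp phi).comp jm = jm := by
    ext l
    cases l
    · change phi (phi (jm X1 : Ar G)) = jm X1
      rw [jm_X, phi_X, map_add, phi_X, phi_Y]; abel
    · change phi (phi (jm Y1 : Ar G)) = jm Y1
      rw [jm_Y, phi_Y, map_neg, phi_Y, neg_neg]
  exact DFunLike.congr_fun this a

theorem phi_jm_range (a : A1) : ∃ b : A1, phi (jm a : Ar G) = jm b := by
  refine A1_ind (fun a => ∃ b : A1, phi (jm a : Ar G) = jm b) ⟨1, by simp⟩ ?_ ?_ ?_ ?_ a
  · rintro a b ⟨a', ha⟩ ⟨b', hb⟩; exact ⟨a' + b', by simp [ha, hb]⟩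
  · rintro c a ⟨a', ha⟩; exact ⟨c • a', by simp [ha]⟩
  · rintro a ⟨a', ha⟩
    exact ⟨a' * X1, by simp [ha, jm_X, jm_Y, phi_X, phi_Y]⟩
  · rintro a ⟨a', ha⟩
    exact ⟨a' * (-Y1), by simp [ha, jm_Y, phi_Y]⟩

theorem cumul_one (L : List (ℕ × G)) (h : ∀ p ∈ L, p.2 = 1) : cumul 1 L = L := by
  induction L with
  | nil => rfl
  | cons p L ih =>
    have hp : p.2 = 1 := h p (by simp)
    have := ih (fun q hq => h q (by simp [hq]))
    obtain ⟨a, s⟩ := p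
    simp only at hp
    subst hp
    simp [cumul, this]

/-- span of the words with all subscripts `1` -/
theorem jm_span (a : A1) : (jm a : Ar G) ∈ Submodule.span ℚ
    {w : Ar G | ∃ (L : List (ℕ × G)) (n : ℕ), (∀ p ∈ L, p.2 = 1) ∧ w = wordP L * Xr ^ n} := by
  set S := Submodule.span ℚ
    {w : Ar G | ∃ (L : List (ℕ × G)) (n : ℕ), (∀ p ∈ L, p.2 = 1) ∧ w = wordP L * Xr ^ n} with hS
  have hmul : ∀ u : Ar G, (∀ (L : List (ℕ × G)) (n : ℕ), (∀ p ∈ L, p.2 = 1) →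
      wordP L * Xr ^ n * u ∈ S) → ∀ w ∈ S, w * u ∈ S := by
    intro u hu w hw
    induction hw using Submodule.span_induction with
    | mem w hw => obtain ⟨L, n, hL, rfl⟩ := hw; exact hu L n hL
    | zero => simp
    | add a b _ _ ha hb => rw [add_mul]; exact S.add_mem ha hb
    | smul c a _ ha => rw [smul_mul_assoc]; exact S.smul_mem c ha
  refine free_ind (S.comap (jm (G := G)).toLinearMap) ?_ ?_ a
  · refine Submodule.subset_span ⟨[], 0, by simp, by simp [wordP]⟩
  · rintro a ha (_ | _)
    · change jm (a * X1) ∈ S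
      rw [map_mul, jm_X]
      refine hmul _ (fun L n hL => Submodule.subset_span ⟨L, n + 1, hL, ?_⟩) _ ha
      rw [pow_succ, mul_assoc]
    · change jm (a * Y1) ∈ S
      rw [map_mul, jm_Y]
      refine hmul _ (fun L n hL => Submodule.subset_span ⟨L ++ [(n, 1)], 0, ?_, ?_⟩) _ ha
      · intro p hp
        rcases List.mem_append.1 hp with hp | hp
        · exact hL p hp
        · simp at hp; simp [hp]
      · simp [wordP, mul_assoc]

theorem psi_jm (a : A1) : ds.psi 1 (jm a) = phi (jm a) := by
  have h := jm_span (G := G) a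
  generalize (jm a : Ar G) = w at h ⊢
  induction h using Submodule.span_induction with
  | mem w hw =>
    obtain ⟨L, n, hL, rfl⟩ := hw
    rw [ds.psi_spec, cumul_one L hL]
  | zero => simp
  | add a b _ _ ha hb => rw [map_add, map_add, ha, hb]
  | smul c a _ ha => rw [map_smul, map_smul, ha]

theorem D1_one (v : A1) : ds.D1 v 1 = v := by
  apply jm_inj (G := G)
  rw [ds.D1_spec, map_one, ds.D_one]
  obtain ⟨b, hb⟩ := phi_jm_range (G := G) v
  rw [hb, psi_jm, ← hb, phi_phi_jm]

theorem one_D1 (v : A1) : ds.D1 1 v = v := by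
  apply jm_inj (G := G)
  rw [ds.D1_spec, ds.one_D]

theorem D1xx (v w : A1) : ds.D1 (v * X1) (w * X1) =
    ds.D1 v (w * X1) * X1 - ds.D1 (v * Y1) w * X1 := by
  apply jm_inj (G := G)
  simp only [ds.D1_spec, map_mul, map_sub, jm_X, ds.Dxx]
theorem D1yx (v w : A1) : ds.D1 (v * Y1) (w * X1) =
    ds.D1 v (w * X1) * Y1 + ds.D1 (v * Y1) w * X1 := by
  apply jm_inj (G := G)
  simp only [ds.D1_spec, map_mul, map_add, jm_X, jm_Y, ds.Dyx]
theorem D1xy (v w : A1) : ds.D1 (v * X1) (w * Y1) =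
    ds.D1 v (w * Y1) * X1 + ds.D1 (v * X1) w * Y1 := by
  apply jm_inj (G := G)
  simp only [ds.D1_spec, map_mul, map_add, jm_X, jm_Y, ds.Dxy]
theorem D1yy (v w : A1) : ds.D1 (v * Y1) (w * Y1) =
    ds.D1 v (w * Y1) * Y1 - ds.D1 (v * X1) w * Y1 := by
  apply jm_inj (G := G)
  simp only [ds.D1_spec, map_mul, map_sub, jm_Y, ds.Dyy]

theorem D1_zl (v w : A1) : ds.D1 (v * (X1 + Y1)) w = ds.D1 v w * (X1 + Y1) := by
  have hx : ∀ w, ds.D1 (v * (X1 + Y1)) (w * X1) = ds.D1 v (w * X1) * (X1 + Y1) := by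
    intro w
    rw [mul_add, map_add, LinearMap.add_apply, D1xx, D1yx]; noncomm_ring
  have hy : ∀ w, ds.D1 (v * (X1 + Y1)) (w * Y1) = ds.D1 v (w * Y1) * (X1 + Y1) := by
    intro w
    rw [mul_add, map_add, LinearMap.add_apply, D1xy, D1yy]; noncomm_ring
  refine A1_ind (fun w => ds.D1 (v * (X1 + Y1)) w = ds.D1 v w * (X1 + Y1)) ?_ ?_ ?_ ?_ ?_ w
  · rw [D1_one, D1_one]
  · intro a b ha hb; rw [map_add, ha, hb, map_add, add_mul]
  · intro c a ha; rw [map_smul, ha, map_smul, smul_mul_assoc]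
  · intro a _; rw [mul_add a, map_add, hx, hy, map_add]; noncomm_ring
  · intro a _; exact hy a

theorem D1_zr (v w : A1) : ds.D1 v (w * (X1 + Y1)) = ds.D1 v w * (X1 + Y1) := by
  refine A1_ind (fun v => ds.D1 v (w * (X1 + Y1)) = ds.D1 v w * (X1 + Y1)) ?_ ?_ ?_ ?_ ?_ v
  · rw [one_D1, one_D1]
  · intro a b ha hb
    rw [map_add, LinearMap.add_apply, ha, hb, LinearMap.add_apply, add_mul]
  · intro c a ha
    rw [map_smul, LinearMap.smul_apply, ha, LinearMap.smul_apply, smul_mul_assoc]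
  · intro a ha; rw [D1_zl, D1_zl, ha]
  · intro a ha
    have h := D1_zl ds a w
    rw [mul_add a, map_add, LinearMap.add_apply] at h
    rw [mul_add w, map_add, D1yx, D1yy]
    rw [mul_add w, map_add] at ha
    have h1 : ds.D1 (a * X1) w = ds.D1 a w * (X1 + Y1) - ds.D1 (a * Y1) w := by
      rw [← h]; abel
    have h2 : ds.D1 a (w * X1) = ds.D1 a w * (X1 + Y1) - ds.D1 a (w * Y1) := by
      rw [← ha]; abel
    rw [h1, h2]; noncomm_ring

theorem D1_yy' (v w : A1) : ds.D1 (v * Y1) (w * Y1) =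
    (ds.D1 v (w * Y1) + ds.D1 (v * Y1) w - ds.D1 v w * (X1 + Y1)) * Y1 := by
  have h := D1_zl ds v w
  rw [mul_add v, map_add, LinearMap.add_apply] at h
  rw [D1yy, ← h]; noncomm_ring

theorem D1_assoc (a b c : A1) : ds.D1 (ds.D1 a b) c = ds.D1 a (ds.D1 b c) := by
  revert b c
  refine A1_ind (fun a => ∀ b c, ds.D1 (ds.D1 a b) c = ds.D1 a (ds.D1 b c)) ?_ ?_ ?_ ?_ ?_ a
  · intro b c; rw [one_D1, one_D1]
  · intro a b ha hb c d; simp only [map_add, LinearMap.add_apply, ha, hb]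
  · intro r a ha c d; simp only [map_smul, LinearMap.smul_apply, ha]
  · intro a ha b c; simp only [D1_zl, ha]
  intro a iha b
  refine A1_ind (fun b => ∀ c, ds.D1 (ds.D1 (a * Y1) b) c = ds.D1 (a * Y1) (ds.D1 b c))
    ?_ ?_ ?_ ?_ ?_ b
  · intro c; rw [one_D1, D1_one]
  · intro b b' ha hb c; simp only [map_add, LinearMap.add_apply, ha, hb]
  · intro r b hb c; simp only [map_smul, LinearMap.smul_apply, hb]
  · intro b hb c; simp only [D1_zl, D1_zr, hb]
  intro b ihb c
  refine A1_ind (fun c => ds.D1 (ds.D1 (a * Y1) (b * Y1)) c =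
    ds.D1 (a * Y1) (ds.D1 (b * Y1) c)) ?_ ?_ ?_ ?_ ?_ c
  · rw [D1_one, D1_one]
  · intro b b' ha hb; simp only [map_add, ha, hb]
  · intro r b hb; simp only [map_smul, hb]
  · intro b hb; simp only [D1_zr, hb]
  intro c ihc
  have e1 : ds.D1 (ds.D1 (a * Y1) (b * Y1)) (c * Y1) =
      (ds.D1 (ds.D1 a (b * Y1) + ds.D1 (a * Y1) b - ds.D1 a b * (X1 + Y1)) (c * Y1)
        + ds.D1 (ds.D1 (a * Y1) (b * Y1)) c
        - ds.D1 (ds.D1 a (b * Y1) + ds.D1 (a * Y1) b - ds.D1 a b * (X1 + Y1)) c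
          * (X1 + Y1)) * Y1 := by
    rw [D1_yy' ds a b, D1_yy']
  have e2 : ds.D1 (a * Y1) (ds.D1 (b * Y1) (c * Y1)) =
      (ds.D1 a (ds.D1 (b * Y1) (c * Y1))
        + ds.D1 (a * Y1) (ds.D1 b (c * Y1) + ds.D1 (b * Y1) c - ds.D1 b c * (X1 + Y1))
        - ds.D1 a (ds.D1 b (c * Y1) + ds.D1 (b * Y1) c - ds.D1 b c * (X1 + Y1))
          * (X1 + Y1)) * Y1 := by
    rw [D1_yy' ds b c, D1_yy']
  rw [e1, e2, ihc]
  simp only [map_add, map_sub, LinearMap.add_apply, LinearMap.sub_apply, D1_zl, D1_zr, iha, ihb]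
  congr 1
  noncomm_ring

end diamond

section ck
variable {G : Type} [CommGroup G] {H : Type} [CommRing H] [HopfAlgebra ℚ H] (C : CKSetup G H)

theorem counit_Bp (f : H) : counit (R := ℚ) (C.Bp f) = 0 := by
  have h := conv_Bp C.Bp C.Bp_cocycle 1 (toConv C.F) f
  rw [one_mul, one_mul, LinearMap.convOne_apply] at h
  have h2 : algebraMap ℚ A1 (counit (R := ℚ) (C.Bp f)) * C.F 1 = 0 := by
    have h3 : C.F (C.Bp f) = algebraMap ℚ A1 (counit (R := ℚ) (C.Bp f)) * C.F 1
      + C.F (C.Bp f) := h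
    exact (right_eq_add.1 h3)
  rw [C.F_one, mul_one] at h2
  exact (map_eq_zero_iff _ (algebraMap ℚ A1).injective).1 h2

theorem zet_ne : (zet : Ar G) ≠ 0 := by
  intro h
  have : (phi (Xr : Ar G)) = 0 := by rw [phi_X]; exact h
  have h2 : phi (phi (Xr : Ar G)) = 0 := by rw [this, map_zero]
  rw [← jm_X, phi_phi_jm, jm_X] at h2
  exact FreeAlgebra.ι_ne_zero _ h2

theorem X_ne : (Xr : Ar G) ≠ 0 := FreeAlgebra.ι_ne_zero _
theorem Y_ne (s : G) : (Yr s : Ar G) ≠ 0 := FreeAlgebra.ι_ne_zero _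

theorem T_z (f : H) : C.T f (zet : Ar G) = counit (R := ℚ) f • zet := by
  let P : Submodule ℚ H :=
    { carrier := {f | C.T f (zet : Ar G) = counit (R := ℚ) f • zet}
      add_mem' := by
        intro a b ha hb
        simp only [Set.mem_setOf_eq] at *
        rw [map_add, map_add, LinearMap.add_apply, ha, hb, add_smul]
      zero_mem' := by simp
      smul_mem' := by
        intro c a ha
        simp only [Set.mem_setOf_eq] at *
        rw [map_smul, map_smul, LinearMap.smul_apply, ha, smul_assoc] }
  refine C.hgen P ?_ ?_ ?_ f
  · change C.T 1 (zet : Ar G) = counit (R := ℚ) (1 : H) • zet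
    simp
  · intro a b ha hb
    change C.T (a * b) (zet : Ar G) = counit (R := ℚ) (a * b) • zet
    change C.T a (zet : Ar G) = counit (R := ℚ) a • zet at ha
    change C.T b (zet : Ar G) = counit (R := ℚ) b • zet at hb
    rw [map_mul, Module.End.mul_apply, hb, map_smul, ha, Bialgebra.counit_mul, smul_smul, mul_comm]
  · intro a _
    change C.T (C.Bp a) (zet : Ar G) = counit (R := ℚ) (C.Bp a) • zet
    rw [C.T_graft_z, counit_Bp, zero_smul]

/-- Evaluation of the rooted tree maps at a word, in the convolution algebra. -/
noncomputable def ev (w : Ar G) : WithConv (H →ₗ[ℚ] Ar G) := toConv (evalT C.T w)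

theorem ev_apply (w : Ar G) (f : H) : ev C w f = C.T f w := rfl

theorem Tpair_eq (w v : Ar G) (f : H) :
    Tpair C.T w v (comul (R := ℚ) f) = (ev C w * ev C v) f := by
  rw [(ℛ ℚ f).convMul_apply, ← (ℛ ℚ f).eq]
  simp [Tpair, ev]

theorem ev_add (w v : Ar G) : ev C (w + v) = ev C w + ev C v := by
  refine conv_ext fun f => ?_
  exact map_add (C.T f) w v

theorem ev_sub (w v : Ar G) : ev C (w - v) = ev C w - ev C v := by
  refine conv_ext fun f => ?_
  exact map_sub (C.T f) w v

theorem ev_smul (c : ℚ) (w : Ar G) : ev C (c • w) = c • ev C w := by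
  refine conv_ext fun f => ?_
  exact map_smul (C.T f) c w

theorem ev_z : ev C (zet : Ar G) = cst zet := conv_ext fun f => T_z C f

theorem ev_mul_gen (w v : Ar G) (hv : v = zet ∨ ∃ s : G, v = zdel s) :
    ev C (w * v) = ev C w * ev C v := by
  refine conv_ext fun f => ?_
  rw [← Tpair_eq, ← C.T_coprod f w v hv, ev_apply]

theorem ev_one : ev C (1 : Ar G) = 1 := by
  refine conv_ext fun f => ?_
  have h := congrArg (fun φ : WithConv (H →ₗ[ℚ] Ar G) => φ f) (ev_mul_gen C 1 zet (Or.inl rfl))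
  simp only [one_mul, ev_z, mul_cst, cst_apply] at h
  rw [LinearMap.convOne_apply, Algebra.algebraMap_eq_smul_one]
  apply mul_right_cancel₀ (zet_ne (G := G))
  rw [← h, smul_mul_assoc, one_mul]

theorem zdel_one : (zdel 1 : Ar G) = Xr := by simp [zdel]

theorem ev_mul (w v : Ar G) : ev C (w * v) = ev C w * ev C v := by
  let P : Submodule ℚ (Ar G) :=
    { carrier := {v | ∀ w, ev C (w * v) = ev C w * ev C v}
      add_mem' := by
        intro a b ha hb w
        rw [mul_add, ev_add, ha, hb, ev_add, mul_add]
      zero_mem' := by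
        intro w
        have h0 : ev C (0 : Ar G) = 0 := conv_ext fun f => map_zero (C.T f)
        rw [mul_zero, h0, mul_zero]
      smul_mem' := by
        intro c a ha w
        rw [mul_smul_comm, ev_smul, ha, ev_smul, mul_smul_comm] }
  have hX : ∀ w, ev C (w * Xr) = ev C w * ev C Xr := by
    intro w
    have := ev_mul_gen C w (zdel 1) (Or.inr ⟨1, rfl⟩)
    rwa [zdel_one] at this
  have hY : ∀ s w, ev C (w * Yr s) = ev C w * ev C (Yr s) := by
    intro s w
    by_cases hs : s = 1
    · have e : (Yr s : Ar G) = zet - Xr := by rw [hs, zet]; abel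
      rw [e, mul_sub, ev_sub, ev_sub, hX, ev_mul_gen C w zet (Or.inl rfl), mul_sub]
    · have e : (Yr s : Ar G) = zdel s - Xr := by rw [zdel, if_neg hs]; abel
      rw [e, mul_sub, ev_sub, ev_sub, hX, ev_mul_gen C w (zdel s) (Or.inr ⟨s, rfl⟩), mul_sub]
  have key : ∀ v, v ∈ P := by
    refine free_ind P ?_ ?_
    · intro w; rw [mul_one, ev_one, mul_one]
    · intro a ha l w
      have hl : ∀ w, ev C (w * FreeAlgebra.ι ℚ l) = ev C w * ev C (FreeAlgebra.ι ℚ l) := by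
        cases l with
        | x => exact hX
        | y s => exact hY s
      rw [← mul_assoc, hl, ha w, hl, mul_assoc]
  exact key v w

/-- right division by `y` -/
theorem exists_div : ∃ K : Ar G →ₗ[ℚ] Ar G, ∀ a, K (a * Yr 1) = a := by
  have hk : LinearMap.ker (LinearMap.mulRight ℚ (Yr 1 : Ar G)) = ⊥ := by
    rw [LinearMap.ker_eq_bot]
    intro a b hab
    exact mul_right_cancel₀ (Y_ne (1 : G)) hab
  obtain ⟨K, hK⟩ := LinearMap.exists_leftInverse_of_injective _ hk
  exact ⟨K, fun a => LinearMap.congr_fun hK a⟩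

theorem counit_sub (f : H) :
    counit (R := ℚ) (f - counit (R := ℚ) f • (1 : H)) = 0 := by
  simp

theorem exists_u : ∃ u : H →ₗ[ℚ] Ar G, ∀ f,
    C.T f Xr = counit (R := ℚ) f • Xr + u f * Yr 1 ∧
    C.T (C.Bp f) Xr = u f * zet * Yr 1 + C.T f Xr * Yr 1 := by
  obtain ⟨K, hK⟩ := exists_div (G := G)
  refine ⟨K ∘ₗ (evalT C.T Xr - (cst (Xr : Ar G) : WithConv (H →ₗ[ℚ] Ar G)).ofConv), fun f => ?_⟩
  set f0 := f - counit (R := ℚ) f • (1 : H) with hf0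
  have h0 : counit (R := ℚ) f0 = 0 := counit_sub f
  have hf : f = f0 + counit (R := ℚ) f • (1 : H) := by rw [hf0]; abel
  obtain ⟨v, hv⟩ := C.T_ends f0 h0 1
  have hg := C.T_graft f0 h0 1 v hv
  have hd := C.T_dot_zdel 1
  have e : (zet - Xr : Ar G) = Yr 1 := by rw [zet]; abel
  rw [zdel_one, e] at hv hg hd
  have hT : C.T f Xr = counit (R := ℚ) f • Xr + v * Yr 1 := by
    conv_lhs => rw [hf]
    rw [map_add, LinearMap.add_apply, hv, map_smul, map_one, add_comm]; rfl
  have hu : (K ∘ₗ (evalT C.T Xr - (cst (Xr : Ar G) : WithConv (H →ₗ[ℚ] Ar G)).ofConv)) f = v := by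
    change K (C.T f Xr - counit (R := ℚ) f • Xr) = v
    rw [hT, add_sub_cancel_left, hK]
  rw [hu]
  refine ⟨hT, ?_⟩
  rw [hT]
  conv_lhs => rw [hf]
  rw [map_add, map_add, LinearMap.add_apply, hg, map_smul, map_smul, LinearMap.smul_apply, hd,
    two_smul, zet, add_mul, smul_mul_assoc]
  noncomm_ring

theorem exists_F (f : H) : ∃ v : A1, C.F f = counit (R := ℚ) f • 1 + v * Y1 ∧
    C.F (C.Bp f) = v * (X1 + Y1) * Y1 + C.F f * Y1 := by
  set f0 := f - counit (R := ℚ) f • (1 : H) with hf0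
  have h0 : counit (R := ℚ) f0 = 0 := counit_sub f
  have hf : f = f0 + counit (R := ℚ) f • (1 : H) := by rw [hf0]; abel
  obtain ⟨v, hv⟩ := C.F_ends f0 h0
  have hg := C.F_graft f0 h0 v hv
  have hT : C.F f = counit (R := ℚ) f • 1 + v * Y1 := by
    conv_lhs => rw [hf]
    rw [map_add, hv, map_smul, C.F_one, add_comm]
  refine ⟨v, hT, ?_⟩
  rw [hT]
  conv_lhs => rw [hf]
  rw [map_add, map_add, hg, map_smul, map_smul, C.F_dot, two_smul, add_mul, smul_mul_assoc, one_mul]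
  noncomm_ring

theorem jm_z : (jm (X1 + Y1) : Ar G) = zet := by rw [map_add, jm_X, jm_Y, zet]

theorem T_main (f : H) : ∀ w : A1, C.T f (Xr * jm w) = Xr * jm (C.ds.D1 (C.F f) w) := by
  let P : Submodule ℚ H :=
    { carrier := {f | ∀ w : A1, C.T f (Xr * jm w) = Xr * jm (C.ds.D1 (C.F f) w)}
      add_mem' := by
        intro a b ha hb w
        rw [map_add, LinearMap.add_apply, ha, hb]
        simp only [map_add, LinearMap.add_apply, mul_add]
      zero_mem' := by intro w; simp
      smul_mem' := by
        intro c a ha w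
        rw [map_smul, LinearMap.smul_apply, ha]
        simp only [map_smul, LinearMap.smul_apply, mul_smul_comm] }
  refine C.hgen P ?_ ?_ ?_ f
  · intro w
    rw [map_one, C.F_one, one_D1]; rfl
  · intro a b ha hb w
    rw [map_mul C.T, Module.End.mul_apply, hb w, ha, C.F_mul, D1_assoc]
  intro f hf
  change ∀ w, _ at hf
  obtain ⟨u, hu⟩ := exists_u C
  obtain ⟨v, hv, hv'⟩ := exists_F C f
  have hY := Y_ne (1 : G)
  -- the conv formula for right multiplication by `x`
  have hconv : ∀ w : Ar G, C.T (C.Bp f) (w * Xr) = C.T (C.Bp f) w * Xr +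
      (C.T f (w * Xr) - C.T f w * Xr) * Yr 1 + C.T f w * Xr * Yr 1
      + (ev C w * toConv u : WithConv (H →ₗ[ℚ] Ar G)) f * zet * Yr 1 ∧
      C.T f (w * Xr) = C.T f w * Xr + (ev C w * toConv u : WithConv (H →ₗ[ℚ] Ar G)) f * Yr 1 := by
    intro w
    have e1 : ev C (Xr : Ar G) = cst Xr + toConv u * cst (Yr 1) := by
      refine conv_ext fun g => ?_
      have h2 : (toConv u * cst (Yr 1) : WithConv (H →ₗ[ℚ] Ar G)) g = u g * Yr 1 := mul_cst _ _ _
      change C.T g Xr = counit (R := ℚ) g • Xr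
        + (toConv u * cst (Yr 1) : WithConv (H →ₗ[ℚ] Ar G)) g
      rw [h2, (hu g).1]
    have e2 : toConv ((ev C (Xr : Ar G)).ofConv ∘ₗ C.Bp) =
        toConv u * cst (zet * Yr 1) + ev C (Xr : Ar G) * cst (Yr 1) := by
      refine conv_ext fun g => ?_
      have h2 : (toConv u * cst (zet * Yr 1) : WithConv (H →ₗ[ℚ] Ar G)) g = u g * (zet * Yr 1) :=
        mul_cst _ _ _
      have h3 : (ev C (Xr : Ar G) * cst (Yr 1) : WithConv (H →ₗ[ℚ] Ar G)) g
        = C.T g Xr * Yr 1 := mul_cst _ _ _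
      change C.T (C.Bp g) Xr = (toConv u * cst (zet * Yr 1) : WithConv (H →ₗ[ℚ] Ar G)) g
        + (ev C (Xr : Ar G) * cst (Yr 1) : WithConv (H →ₗ[ℚ] Ar G)) g
      rw [h2, h3, (hu g).2, mul_assoc]
    have h1 : C.T f (w * Xr) =
        C.T f w * Xr + (ev C w * toConv u : WithConv (H →ₗ[ℚ] Ar G)) f * Yr 1 := by
      rw [← ev_apply, ev_mul, e1, mul_add, ← mul_assoc, ofConv_add, LinearMap.add_apply, mul_cst,
        mul_cst, ev_apply]
    refine ⟨?_, h1⟩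
    have h3 := conv_Bp C.Bp C.Bp_cocycle (ev C w) (ev C Xr) f
    rw [← ev_mul, e2, mul_add, ← mul_assoc, ← mul_assoc, ← ev_mul, ofConv_add,
      LinearMap.add_apply, mul_cst, mul_cst] at h3
    simp only [ev_apply] at h3
    rw [h3, map_one, Module.End.one_apply]
    noncomm_ring
  intro w
  refine A1_ind (fun w => C.T (C.Bp f) (Xr * jm w) = Xr * jm (C.ds.D1 (C.F (C.Bp f)) w))
    ?_ ?_ ?_ ?_ ?_ w
  · rw [D1_one, map_one, mul_one, (hu f).2]
    have h1 := hf 1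
    rw [map_one, mul_one, D1_one] at h1
    have h2 := (hu f).1
    rw [h1, hv, map_add, map_smul, map_one, map_mul, jm_Y, mul_add, mul_smul_comm, mul_one,
      add_right_inj, ← mul_assoc] at h2
    have h3 := mul_right_cancel₀ hY h2
    rw [h1, ← h3, hv', map_add, map_mul, map_mul, jm_z, jm_Y, map_mul, jm_Y]
    noncomm_ring
  · intro a b ha hb
    simp only [map_add, mul_add, ha, hb]
  · intro c a ha
    simp only [map_smul, mul_smul_comm, ha]
  · intro a ha
    rw [D1_zr, map_mul (jm (G := G)), map_mul (jm (G := G)), jm_z, ← mul_assoc, ← mul_assoc, ← ha, ← ev_apply, ev_mul, ev_z,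
      mul_cst, ev_apply]
  · intro a ha
    have hz : C.T (C.Bp f) (Xr * jm (a * (X1 + Y1))) =
        Xr * jm (C.ds.D1 (C.F (C.Bp f)) (a * (X1 + Y1))) := by
      rw [D1_zr, map_mul (jm (G := G)), map_mul (jm (G := G)), jm_z, ← mul_assoc, ← mul_assoc, ← ha, ← ev_apply, ev_mul, ev_z,
        mul_cst, ev_apply]
    have hx : C.T (C.Bp f) (Xr * jm (a * X1)) =
        Xr * jm (C.ds.D1 (C.F (C.Bp f)) (a * X1)) := by
      obtain ⟨h1, h2⟩ := hconv (Xr * jm a)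
      have e : Xr * jm a * (Xr : Ar G) = Xr * jm (a * X1) := by rw [map_mul, jm_X, mul_assoc]
      rw [e] at h1 h2
      rw [hf, hf] at h2
      have hD : C.ds.D1 (C.F f) (a * X1) =
          C.ds.D1 v (a * X1) * Y1 + C.ds.D1 (C.F f) a * X1 := by
        rw [hv]
        simp only [map_add, LinearMap.add_apply, D1yx, map_smul, LinearMap.smul_apply, one_D1,
          add_mul, smul_mul_assoc]
        abel
      have h3 : (ev C (Xr * jm a) * toConv u : WithConv (H →ₗ[ℚ] Ar G)) f
          = Xr * jm (C.ds.D1 v (a * X1)) := by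
        apply mul_right_cancel₀ hY
        rw [hD, map_add, map_mul (jm (G := G)), map_mul (jm (G := G)), jm_X, jm_Y, mul_add, mul_assoc Xr (jm _) Xr, add_comm,
          add_right_inj] at h2
        rw [← h2, mul_assoc]
      rw [h1, h3, hf, hf, ha, hv']
      simp only [map_add, LinearMap.add_apply, D1yx, D1_zl, map_mul, jm_X, jm_Y, zet]
      noncomm_ring
    rw [mul_add a, map_add, mul_add, map_add, hx, map_add, map_add, mul_add, add_right_inj] at hz
    exact hz

end ck

section tau
variable {G : Type} [CommGroup G] {H : Type} [CommRing H] [HopfAlgebra ℚ H] (C : CKSetup G H)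

section cstlemmas
variable {A : Type} [Ring A] [Algebra ℚ A]

theorem cst_mul_cst (a b : A) : (cst a * cst b : WithConv (H →ₗ[ℚ] A)) = cst (a * b) := by
  refine conv_ext fun f => ?_
  rw [cst_mul, cst_apply, cst_apply, mul_smul_comm]

theorem cst_one : (cst 1 : WithConv (H →ₗ[ℚ] A)) = 1 := by
  refine conv_ext fun f => ?_
  rw [LinearMap.convOne_apply, cst_apply, Algebra.algebraMap_eq_smul_one]

theorem cst_add (a b : A) : (cst (a + b) : WithConv (H →ₗ[ℚ] A)) = cst a + cst b := by
  refine conv_ext fun f => ?_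
  change counit (R := ℚ) f • (a + b) = counit (R := ℚ) f • a + counit (R := ℚ) f • b
  rw [smul_add]

theorem cst_sub (a b : A) : (cst (a - b) : WithConv (H →ₗ[ℚ] A)) = cst a - cst b := by
  refine conv_ext fun f => ?_
  change counit (R := ℚ) f • (a - b) = counit (R := ℚ) f • a - counit (R := ℚ) f • b
  rw [smul_sub]

theorem cst_smul (c : ℚ) (a : A) : (cst (c • a) : WithConv (H →ₗ[ℚ] A)) = c • cst a := by
  refine conv_ext fun f => ?_
  change counit (R := ℚ) f • (c • a) = c • (counit (R := ℚ) f • a)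
  rw [smul_comm]

theorem one_apply' (f : H) : (1 : WithConv (H →ₗ[ℚ] A)) f = counit (R := ℚ) f • 1 := by
  rw [LinearMap.convOne_apply, Algebra.algebraMap_eq_smul_one]

theorem add_apply' (φ ψ : WithConv (H →ₗ[ℚ] A)) (f : H) : (φ + ψ) f = φ f + ψ f := rfl
theorem sub_apply' (φ ψ : WithConv (H →ₗ[ℚ] A)) (f : H) : (φ - ψ) f = φ f - ψ f := rfl
theorem neg_apply' (φ : WithConv (H →ₗ[ℚ] A)) (f : H) : (-φ) f = -φ f := rfl
theorem smul_apply' (c : ℚ) (φ : WithConv (H →ₗ[ℚ] A)) (f : H) : (c • φ) f = c • φ f := rfl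

end cstlemmas

theorem c_one_mul (φ : WithConv (H →ₗ[ℚ] Module.End ℚ (Ar G))) : 1 * φ = φ := one_mul φ
theorem c_mul_one (φ : WithConv (H →ₗ[ℚ] Module.End ℚ (Ar G))) : φ * 1 = φ := mul_one φ
theorem c_mul_neg (φ ψ : WithConv (H →ₗ[ℚ] Module.End ℚ (Ar G))) : φ * -ψ = -(φ * ψ) := by
  refine eq_neg_of_add_eq_zero_left ?_
  rw [← mul_add, neg_add_cancel, mul_zero]
theorem c_mul_sub (φ ψ χ : WithConv (H →ₗ[ℚ] Module.End ℚ (Ar G))) :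
    φ * (ψ - χ) = φ * ψ - φ * χ := by
  refine eq_sub_of_add_eq ?_
  rw [← mul_add, sub_add_cancel]
theorem e_neg_mul (φ ψ : Module.End ℚ (Ar G)) : -φ * ψ = -(φ * ψ) := neg_mul φ ψ

/-- Left multiplication. -/
noncomputable def LL : Ar G →ₐ[ℚ] Module.End ℚ (Ar G) := Algebra.lmul ℚ (Ar G)

theorem LL_apply (a b : Ar G) : LL a b = a * b := rfl

theorem LL_cancel {a : Ar G} (ha : a ≠ 0) {p q : Module.End ℚ (Ar G)}
    (h : LL a * p = LL a * q) : p = q := by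
  ext v
  exact mul_left_cancel₀ ha (LinearMap.congr_fun h v)

/-- rooted tree maps in the convolution algebra -/
noncomputable def cT : WithConv (H →ₗ[ℚ] Module.End ℚ (Ar G)) := toConv C.T.toLinearMap

/-- its convolution inverse -/
noncomputable def cTi : WithConv (H →ₗ[ℚ] Module.End ℚ (Ar G)) :=
  toConv (C.T.toLinearMap ∘ₗ HopfAlgebra.antipode ℚ)

theorem cT_apply (f : H) : cT C f = C.T f := rfl
theorem cTi_apply (f : H) : cTi C f = C.T (HopfAlgebra.antipode ℚ f) := rfl
theorem cT_cTi : cT C * cTi C = 1 := conv_antipode C.T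
theorem cTi_cT : cTi C * cT C = 1 := antipode_conv C.T

/-- left multiplication by the values of a linear map -/
noncomputable def lft (φ : H →ₗ[ℚ] Ar G) : WithConv (H →ₗ[ℚ] Module.End ℚ (Ar G)) :=
  toConv (LL.toLinearMap ∘ₗ φ)

theorem lft_apply (φ : H →ₗ[ℚ] Ar G) (f : H) : lft φ f = LL (φ f) := rfl

theorem lft_conv (φ : H →ₗ[ℚ] Ar G) (f : H) (v : Ar G) :
    (lft φ * cT C : WithConv (H →ₗ[ℚ] Module.End ℚ (Ar G))) f v
      = (toConv φ * ev C v : WithConv (H →ₗ[ℚ] Ar G)) f := by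
  rw [(ℛ ℚ f).convMul_apply, (ℛ ℚ f).convMul_apply, LinearMap.sum_apply]
  rfl

/-- `jm ∘ F` -/
noncomputable def jF : H →ₗ[ℚ] Ar G := (jm (G := G)).toLinearMap ∘ₗ C.F

theorem jF_apply (f : H) : jF C f = jm (C.F f) := rfl

theorem T_X (f : H) : C.T f Xr = Xr * jF C f := by
  have h := T_main C f 1
  rwa [map_one, mul_one, D1_one] at h

theorem ev_X : ev C (Xr : Ar G) = cst Xr * toConv (jF C) := by
  refine conv_ext fun f => ?_
  rw [cst_mul, ev_apply, T_X]

theorem T_mul_X (f : H) :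
    C.T f * LL Xr = LL Xr * (lft (jF C) * cT C : WithConv (H →ₗ[ℚ] Module.End ℚ (Ar G))) f := by
  ext v
  rw [Module.End.mul_apply, Module.End.mul_apply, LL_apply, LL_apply, lft_conv, ← ev_apply,
    ev_mul, ev_X, mul_assoc, cst_mul]

theorem cT_X : cT C * cst (LL Xr) = cst (LL Xr) * (lft (jF C) * cT C) := by
  refine conv_ext fun f => ?_
  rw [mul_cst, cst_mul, cT_apply, T_mul_X]

theorem cT_z : cT C * cst (LL zet) = cst (LL zet) * cT C := by
  refine conv_ext fun f => ?_
  rw [mul_cst, cst_mul, cT_apply]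
  ext v
  rw [Module.End.mul_apply, Module.End.mul_apply, LL_apply, LL_apply, ← ev_apply,
    ev_mul, ev_z, cst_mul, ev_apply]

theorem cTi_z : cTi C * cst (LL zet) = cst (LL zet) * cTi C := by
  calc cTi C * cst (LL zet) = cTi C * (cst (LL zet) * (cT C * cTi C)) := by rw [cT_cTi, c_mul_one]
    _ = cTi C * (cst (LL zet) * cT C) * cTi C := by simp only [mul_assoc]
    _ = cTi C * (cT C * cst (LL zet)) * cTi C := by rw [cT_z]
    _ = (cTi C * cT C) * (cst (LL zet) * cTi C) := by simp only [mul_assoc]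
    _ = _ := by rw [cTi_cT, c_one_mul]

theorem adj_z {a : Ar G} (ha : a ∈ Algebra.adjoin ℚ {(zet : Ar G)}) : a * zet = zet * a := by
  induction ha using Algebra.adjoin_induction with
  | mem x hx => rw [Set.mem_singleton_iff.1 hx]
  | algebraMap r => exact Algebra.commutes r _
  | add x y _ _ hx hy => rw [add_mul, hx, hy, mul_add]
  | mul x y _ _ hx hy => rw [mul_assoc, hy, ← mul_assoc, hx, mul_assoc]

theorem cT_adj {a : Ar G} (ha : a ∈ Algebra.adjoin ℚ {(zet : Ar G)}) :
    cT C * cst (LL a) = cst (LL a) * cT C := by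
  induction ha using Algebra.adjoin_induction with
  | mem x hx => rw [Set.mem_singleton_iff.1 hx, cT_z]
  | algebraMap r =>
    rw [AlgHom.commutes, Algebra.algebraMap_eq_smul_one, cst_smul, cst_one, mul_smul_comm,
      smul_mul_assoc, c_one_mul, c_mul_one]
  | add x y _ _ hx hy => rw [map_add, cst_add, mul_add, add_mul, hx, hy]
  | mul x y _ _ hx hy =>
    rw [map_mul, ← cst_mul_cst, ← mul_assoc, hx, mul_assoc, hy, mul_assoc]

/-- `Ẽ` as an algebra homomorphism -/
noncomputable def Eh : H →ₐ[ℚ] Module.End ℚ (Ar G) :=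
  AlgHom.ofLinearMap (lft (jF C) * cT C : WithConv (H →ₗ[ℚ] Module.End ℚ (Ar G))).ofConv
    (by
      apply LL_cancel (X_ne (G := G))
      rw [← T_mul_X, map_one, mul_one, one_mul])
    (by
      intro f g
      apply LL_cancel (X_ne (G := G))
      rw [← T_mul_X, map_mul, ← mul_assoc, ← T_mul_X, mul_assoc, mul_assoc, ← T_mul_X])

theorem Eh_conv : toConv (Eh C).toLinearMap = lft (jF C) * cT C := rfl

theorem Eh_one (f : H) : Eh C f 1 = jF C f := by
  apply mul_left_cancel₀ (X_ne (G := G))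
  rw [← T_X]
  have h := LinearMap.congr_fun (T_mul_X C f) 1
  rw [Module.End.mul_apply, LL_apply, mul_one] at h
  rw [h]; rfl

/-- inverse of `Ẽ` -/
noncomputable def cE : WithConv (H →ₗ[ℚ] Module.End ℚ (Ar G)) :=
  toConv ((Eh C).toLinearMap ∘ₗ HopfAlgebra.antipode ℚ)

theorem cE_one (f : H) : cE C f 1 = jF C (HopfAlgebra.antipode ℚ f) := Eh_one C _

theorem E_cE : lft (jF C) * cT C * cE C = 1 := conv_antipode (Eh C)
theorem cE_E : cE C * (lft (jF C) * cT C) = 1 := antipode_conv (Eh C)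

theorem cE_mul (a b : H) : cE C (a * b) = cE C a * cE C b := by
  change Eh C (HopfAlgebra.antipode ℚ (a * b)) =
    Eh C (HopfAlgebra.antipode ℚ a) * Eh C (HopfAlgebra.antipode ℚ b)
  rw [HopfAlgebra.antipode_mul_distrib, map_mul]

theorem cE_one' : cE C 1 = 1 := by
  change Eh C (HopfAlgebra.antipode ℚ 1) = 1
  rw [HopfAlgebra.antipode_one, map_one]

/-- the series `τ` -/
noncomputable def ct : WithConv (H →ₗ[ℚ] Module.End ℚ (Ar G)) := cT C * cE C

theorem LF_ct : lft (jF C) * ct C = 1 := by rw [ct, ← mul_assoc, E_cE]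

theorem ct_LF : ct C * lft (jF C) = 1 := by
  calc ct C * lft (jF C) = ct C * (lft (jF C) * (cT C * cTi C)) := by rw [cT_cTi, c_mul_one]
    _ = cT C * (cE C * (lft (jF C) * cT C)) * cTi C := by rw [ct]; simp only [mul_assoc]
    _ = 1 := by rw [cE_E, c_mul_one, cT_cTi]

theorem cTi_ct : cTi C * ct C = cE C := by rw [ct, ← mul_assoc, cTi_cT, c_one_mul]

theorem ct_X : cT C * cst (LL Xr) * cE C = cst (LL Xr) := by
  rw [cT_X, mul_assoc, E_cE, c_mul_one]

theorem ct_one : ct C 1 = 1 := by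
  have h := congrArg (fun φ : WithConv (H →ₗ[ℚ] Module.End ℚ (Ar G)) => φ 1) (LF_ct C)
  simp only [one_apply'] at h
  rw [ct, LinearMap.convMul_apply, Bialgebra.comul_one, Algebra.TensorProduct.one_def]
  simp only [TensorProduct.map_tmul, LinearMap.mul'_apply]
  rw [cE_one', mul_one]
  exact map_one C.T

/-- right multiplication -/
noncomputable def MR (v : Ar G) : Module.End ℚ (Ar G) := LinearMap.mulRight ℚ v

theorem MR_apply (v a : Ar G) : MR v a = a * v := rfl

theorem lft_MR (φ : H →ₗ[ℚ] Ar G) (v : Ar G) : lft φ * cst (MR v) = cst (MR v) * lft φ := by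
  refine conv_ext fun f => ?_
  rw [mul_cst, cst_mul, lft_apply]
  ext w
  simp only [Module.End.mul_apply, LL_apply, MR_apply, mul_assoc]

theorem ct_MR (v : Ar G) : ct C * cst (MR v) = cst (MR v) * ct C := by
  calc ct C * cst (MR v) = ct C * (cst (MR v) * (lft (jF C) * ct C)) := by rw [LF_ct, c_mul_one]
    _ = ct C * (cst (MR v) * lft (jF C)) * ct C := by simp only [mul_assoc]
    _ = ct C * (lft (jF C) * cst (MR v)) * ct C := by rw [lft_MR]
    _ = (ct C * lft (jF C)) * (cst (MR v) * ct C) := by simp only [mul_assoc]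
    _ = _ := by rw [ct_LF, c_one_mul]

theorem exists_Fu : ∃ u : H →ₗ[ℚ] Ar G, ∀ f,
    jF C f = counit (R := ℚ) f • 1 + u f * Yr 1 ∧
    jF C (C.Bp f) = u f * zet * Yr 1 + jF C f * Yr 1 := by
  obtain ⟨K, hK⟩ := exists_div (G := G)
  refine ⟨K ∘ₗ (jF C - (cst (1 : Ar G) : WithConv (H →ₗ[ℚ] Ar G)).ofConv), fun f => ?_⟩
  obtain ⟨v, h1, h2⟩ := exists_F C f
  have h1' : jF C f = counit (R := ℚ) f • 1 + jm v * Yr 1 := by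
    rw [jF_apply, h1, map_add, map_smul, map_one, map_mul, jm_Y]
  have hu : (K ∘ₗ (jF C - (cst (1 : Ar G) : WithConv (H →ₗ[ℚ] Ar G)).ofConv)) f = jm v := by
    change K (jF C f - counit (R := ℚ) f • 1) = jm v
    rw [h1', add_sub_cancel_left, hK]
  rw [hu]
  refine ⟨h1', ?_⟩
  rw [jF_apply, h2, map_add, map_mul (jm (G := G)), map_mul (jm (G := G)), jm_z, jm_Y,
    map_mul (jm (G := G)), jm_Y, jF_apply]

theorem Y_eq : (Yr 1 : Ar G) = zet - Xr := by rw [zet]; abel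

/-- key property of `τ` -/
def Good (f : H) : Prop := ∃ a ∈ Algebra.adjoin ℚ {(zet : Ar G)},
  ct C f = counit (R := ℚ) f • 1 + LL a * LL (Yr 1)

theorem good_mul (f g : H) (hf : Good C f) (hg : Good C g) : Good C (f * g) := by
  obtain ⟨a, ha, hfa⟩ := hf
  obtain ⟨b, hb, hgb⟩ := hg
  have hz : (zet : Ar G) ∈ Algebra.adjoin ℚ {(zet : Ar G)} := Algebra.subset_adjoin rfl
  refine ⟨counit (R := ℚ) f • b + counit (R := ℚ) g • a + a * zet * b, ?_, ?_⟩
  · exact add_mem (add_mem (Subalgebra.smul_mem _ hb _) (Subalgebra.smul_mem _ ha _))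
      (mul_mem (mul_mem ha hz) hb)
  have h := conv_mul_mul (cT C) (cE C) (map_mul C.T) (cE_mul C) f g
  have e : cT C * cst ((cT C * cE C : WithConv (H →ₗ[ℚ] Module.End ℚ (Ar G))) f) * cE C =
      counit (R := ℚ) f • ct C + cst (LL a) * (cst (LL zet) * ct C - cst (LL Xr)) := by
    change cT C * cst (ct C f) * cE C = _
    rw [hfa, cst_add, cst_smul, cst_one, Y_eq, map_sub, mul_sub, cst_sub, ← cst_mul_cst,
      ← cst_mul_cst, mul_add, mul_sub (cT C), ← mul_assoc, ← mul_assoc, cT_adj C ha,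
      mul_assoc (cst (LL a)), mul_assoc (cst (LL a)), cT_z, add_mul, sub_mul,
      mul_assoc (cst (LL a)), mul_assoc (cst (LL a)), ct_X, mul_smul_comm, c_mul_one, smul_mul_assoc,
      mul_assoc (cst (LL zet)), mul_sub]
    rfl
  rw [e, add_apply', cst_mul, sub_apply', cst_mul, smul_apply', cst_apply, hgb] at h
  change ct C (f * g) = _ at h
  rw [h, Bialgebra.counit_mul, map_add, map_add, map_smul, map_smul, map_mul, map_mul, Y_eq,
    map_sub]
  simp only [smul_add, mul_add, add_mul, smul_mul_assoc, mul_smul_comm, mul_sub, sub_mul, smul_sub,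
    mul_one, smul_smul, mul_assoc]
  abel

theorem good_Bp (f : H) (hf : Good C f) : Good C (C.Bp f) ∧
    ct C (C.Bp f) = LL zet * ct C f - counit (R := ℚ) f • (LL zet + LL (Yr 1)) := by
  obtain ⟨a, ha, hfa⟩ := hf
  obtain ⟨u, hu⟩ := exists_Fu C
  have hz : (zet : Ar G) ∈ Algebra.adjoin ℚ {(zet : Ar G)} := Algebra.subset_adjoin rfl
  have e1 : lft (jF C) = 1 + lft u * cst (LL (Yr 1)) := by
    refine conv_ext fun g => ?_
    rw [add_apply', mul_cst, one_apply', lft_apply, (hu g).1, map_add, map_smul, map_one, map_mul,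
      lft_apply]
  have e2 : lft (jF C ∘ₗ C.Bp) = lft u * cst (LL zet * LL (Yr 1)) + lft (jF C) * cst (LL (Yr 1)) := by
    refine conv_ext fun g => ?_
    rw [add_apply', mul_cst, mul_cst, lft_apply, lft_apply, lft_apply, LinearMap.comp_apply,
      (hu g).2, map_add, map_mul, map_mul, map_mul, mul_assoc]
  have e3 : lft (jF C) * toConv ((ct C).ofConv ∘ₗ C.Bp) = - lft (jF C ∘ₗ C.Bp) := by
    refine conv_ext fun g => ?_
    have h := conv_Bp C.Bp C.Bp_cocycle (lft (jF C)) (ct C) g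
    rw [LF_ct, one_apply', counit_Bp, zero_smul, ct_one, mul_one] at h
    rw [neg_apply', ← add_eq_zero_iff_eq_neg, add_comm]
    exact h.symm
  have e4 : toConv ((ct C).ofConv ∘ₗ C.Bp) =
      - (ct C * lft u * cst (LL zet * LL (Yr 1)) + cst (LL (Yr 1))) := by
    have h := congrArg (ct C * ·) e3
    beta_reduce at h
    rw [← mul_assoc, ct_LF, c_one_mul, e2, c_mul_neg, mul_add, ← mul_assoc, ← mul_assoc, ct_LF,
      c_one_mul] at h
    exact h
  set W := (ct C * lft u : WithConv (H →ₗ[ℚ] Module.End ℚ (Ar G))) f with hW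
  have h5 : counit (R := ℚ) f • (1 : Module.End ℚ (Ar G)) = ct C f + W * LL (Yr 1) := by
    have h := ct_LF C
    rw [e1, mul_add, c_mul_one, ← mul_assoc] at h
    have h' := congrArg (fun φ : WithConv (H →ₗ[ℚ] Module.End ℚ (Ar G)) => φ f) h
    beta_reduce at h'
    rw [add_apply', mul_cst, one_apply'] at h'
    exact h'.symm
  have h6 : W * LL (Yr 1) = - (LL a * LL (Yr 1)) := by
    rw [hfa, add_assoc, left_eq_add] at h5
    exact eq_neg_of_add_eq_zero_right h5
  have hWR : ∀ v w, W (w * v) = W w * v := by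
    intro v w
    have h : ct C * lft u * cst (MR v) = cst (MR v) * (ct C * lft u) := by
      rw [mul_assoc, lft_MR, ← mul_assoc, ct_MR, mul_assoc]
    have h' := congrArg (fun φ : WithConv (H →ₗ[ℚ] Module.End ℚ (Ar G)) => φ f w) h
    beta_reduce at h'
    rw [mul_cst, cst_mul] at h'
    exact h'
  have hW1 : W 1 = - a := by
    apply mul_right_cancel₀ (Y_ne (1 : G))
    rw [← hWR, one_mul]
    have h := LinearMap.congr_fun h6 1
    rw [Module.End.mul_apply, LL_apply, mul_one] at h
    rw [h, LinearMap.neg_apply, Module.End.mul_apply, LL_apply, LL_apply, mul_one, neg_mul]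
  have hWa : W = - LL a := by
    ext v
    have := hWR v 1
    rw [one_mul, hW1] at this
    rw [this, LinearMap.neg_apply, LL_apply, neg_mul]
  have h7 : ct C (C.Bp f) = LL a * (LL zet * LL (Yr 1)) - counit (R := ℚ) f • LL (Yr 1) := by
    have h := congrArg (fun φ : WithConv (H →ₗ[ℚ] Module.End ℚ (Ar G)) => φ f) e4
    beta_reduce at h
    rw [neg_apply', add_apply', mul_cst, cst_apply, ← hW, hWa] at h
    change ct C (C.Bp f) = _ at h
    rw [h]
    rw [e_neg_mul, neg_add, neg_neg, sub_eq_add_neg]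
  refine ⟨⟨a * zet - counit (R := ℚ) f • 1, ?_, ?_⟩, ?_⟩
  · exact sub_mem (mul_mem ha hz) (Subalgebra.smul_mem _ (one_mem _) _)
  · rw [h7, counit_Bp, zero_smul, zero_add, map_sub, map_smul, map_one, map_mul, sub_mul,
      smul_mul_assoc, one_mul, mul_assoc]
  · rw [h7, hfa, mul_add, ← mul_assoc, ← mul_assoc, ← map_mul LL a, ← map_mul LL zet a, adj_z ha,
      mul_smul_comm, mul_one, smul_add]
    abel

theorem good (f : H) : Good C f := by
  let P : Submodule ℚ H :=
    { carrier := {f | Good C f}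
      add_mem' := by
        rintro f g ⟨a, ha, hf⟩ ⟨b, hb, hg⟩
        refine ⟨a + b, add_mem ha hb, ?_⟩
        rw [map_add, hf, hg, map_add, map_add, add_smul, add_mul]
        abel
      zero_mem' := ⟨0, zero_mem _, by simp⟩
      smul_mem' := by
        rintro c f ⟨a, ha, hf⟩
        refine ⟨c • a, Subalgebra.smul_mem _ ha _, ?_⟩
        rw [map_smul, hf, map_smul, map_smul, smul_add, smul_assoc, smul_mul_assoc] }
  refine C.hgen P ?_ ?_ ?_ f
  · refine ⟨0, zero_mem _, ?_⟩
    rw [ct_one]; simp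
  · intro a b ha hb; exact good_mul C a b ha hb
  · intro a ha; exact (good_Bp C a ha).1

theorem T_unit (f : H) : C.T f (1 : Ar G) = counit (R := ℚ) f • 1 := by
  rw [← ev_apply, ev_one, one_apply']

theorem jF_S_Bp (f : H) : jF C (HopfAlgebra.antipode ℚ (C.Bp f)) =
    (zet + Xr) * jF C (HopfAlgebra.antipode ℚ f) - (2 * counit (R := ℚ) f) • zet := by
  have e1 : cT C * toConv ((cE C).ofConv ∘ₗ C.Bp) =
      cst (LL zet) * ct C - cst (LL zet + LL (Yr 1)) - toConv (C.T.toLinearMap ∘ₗ C.Bp) := by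
    refine conv_ext fun g => ?_
    have h := conv_Bp C.Bp C.Bp_cocycle (cT C) (cE C) g
    rw [cE_one', mul_one] at h
    change ct C (C.Bp g) = _ at h
    rw [(good_Bp C g (good C g)).2] at h
    rw [sub_apply', sub_apply', cst_mul, cst_apply, h, cT_apply]
    change _ = _ - C.T (C.Bp g)
    abel
  have e2 : toConv ((cE C).ofConv ∘ₗ C.Bp) =
      cst (LL zet) * cE C - cTi C * cst (LL zet + LL (Yr 1))
        - cTi C * toConv (C.T.toLinearMap ∘ₗ C.Bp) := by
    have h := congrArg (cTi C * ·) e1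
    beta_reduce at h
    rw [← mul_assoc, cTi_cT, c_one_mul, c_mul_sub, c_mul_sub, ← mul_assoc, cTi_z, mul_assoc,
      cTi_ct] at h
    exact h
  have h0 : (cTi C * toConv (C.T.toLinearMap ∘ₗ C.Bp) :
      WithConv (H →ₗ[ℚ] Module.End ℚ (Ar G))) f 1 = 0 := by
    rw [(ℛ ℚ f).convMul_apply, LinearMap.sum_apply]
    refine Finset.sum_eq_zero fun i _ => ?_
    change cTi C _ (C.T (C.Bp _) 1) = 0
    rw [T_unit, counit_Bp, zero_smul, map_zero]
  have h := congrArg (fun φ : WithConv (H →ₗ[ℚ] Module.End ℚ (Ar G)) => φ f 1) e2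
  beta_reduce at h
  rw [sub_apply', sub_apply', LinearMap.sub_apply, LinearMap.sub_apply, h0, cst_mul, mul_cst,
    Module.End.mul_apply, Module.End.mul_apply, LL_apply, cE_one, sub_zero, LinearMap.add_apply,
    LL_apply, LL_apply, mul_one, mul_one, cTi_apply, Y_eq, map_add, map_sub, T_z, T_X,
    HopfAlgebra.counit_antipode] at h
  change cE C (C.Bp f) 1 = _ at h
  rw [cE_one] at h
  rw [h, two_mul, add_smul, add_mul]
  abel

theorem F_S_Bp (f : H) : C.F (HopfAlgebra.antipode ℚ (C.Bp f)) =
    ((2 : ℚ) • X1 + Y1) * C.F (HopfAlgebra.antipode ℚ f)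
      - (2 * counit (R := ℚ) f) • (X1 + Y1) := by
  apply jm_inj (G := G)
  rw [← jF_apply, jF_S_Bp, map_sub, map_smul, jm_z, map_mul (jm (G := G)), ← jF_apply, map_add,
    map_smul, jm_X, jm_Y, two_smul, zet]
  congr 2
  abel

theorem Gm_eq (f : H) : C.Gm f = C.F (HopfAlgebra.antipode ℚ f) := by
  let P : Submodule ℚ H := LinearMap.eqLocus C.Gm (C.F ∘ₗ HopfAlgebra.antipode ℚ)
  refine C.hgen P ?_ ?_ ?_ f
  · change C.Gm 1 = C.F (HopfAlgebra.antipode ℚ 1)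
    rw [HopfAlgebra.antipode_one, C.Gm_one, C.F_one]
  · intro a b ha hb
    change C.Gm a = C.F (HopfAlgebra.antipode ℚ a) at ha
    change C.Gm b = C.F (HopfAlgebra.antipode ℚ b) at hb
    change C.Gm (a * b) = C.F (HopfAlgebra.antipode ℚ (a * b))
    rw [HopfAlgebra.antipode_mul_distrib, C.Gm_mul, C.F_mul, ha, hb]
  · intro f hf
    change C.Gm f = C.F (HopfAlgebra.antipode ℚ f) at hf
    change C.Gm (C.Bp f) = C.F (HopfAlgebra.antipode ℚ (C.Bp f))
    rw [F_S_Bp, ← hf]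
    set f0 := f - counit (R := ℚ) f • (1 : H) with hf0
    have h0 : counit (R := ℚ) f0 = 0 := counit_sub f
    have hf' : f = f0 + counit (R := ℚ) f • (1 : H) := by rw [hf0]; abel
    have hg := C.Gm_graft f0 h0
    have h1 : C.Gm (C.Bp f) = C.Gm (C.Bp f0) - counit (R := ℚ) f • Y1 := by
      conv_lhs => rw [hf']
      rw [map_add, map_add, map_smul, map_smul, C.Gm_dot, smul_neg, sub_eq_add_neg]
    rw [h1, hg, hf0, map_sub, map_smul, C.Gm_one, mul_sub, mul_smul_comm, mul_one, two_smul,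
      two_mul, add_smul]
    simp only [smul_add]
    abel

end tau
end RTM

open TensorProduct in
/-- For `f ∈ Aug(H)` with `Δ(f) = Σ f' ⊗ f''`, one has `Σ F_{f'} ⋄_1 G_{f''} = 0` in `A_1`. -/
theorem statement17 {G : Type} [CommGroup G] {H : Type} [CommRing H] [HopfAlgebra ℚ H]
    (C : CKSetup G H) (f : H) (hf : Coalgebra.counit (R := ℚ) f = 0) :
    TensorProduct.lift ((C.ds.D1.comp C.F).compl₂ C.Gm) (Coalgebra.comul (R := ℚ) f) = 0 := by
  have h := congrArg C.F
    (HopfAlgebra.sum_mul_antipode_eq_algebraMap_counit (Coalgebra.Repr.arbitrary ℚ f))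
  rw [hf, map_zero, map_zero, map_sum] at h
  rw [← (Coalgebra.Repr.arbitrary ℚ f).eq, map_sum, ← h]
  refine Finset.sum_congr rfl fun i _ => ?_
  rw [TensorProduct.lift.tmul, C.F_mul, ← RTM.Gm_eq]
  rfl
end
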